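/- arXiv:2410.20512 — 6 statements merged into one kernel-verified Lean document; each statement's English description precedes it below -/
import Mathlib

section
/- Let (W,S) be a finite Coxeter system with length function ℓ, and let I, J ⊆ S with standard parabolic subgroups W_I = ⟨I⟩ and W_J = ⟨J⟩. Let X ⊆ W be the set of elements x such that ℓ(x) ≤ ℓ(ux) for all u ∈ W_I (x has minimal length in its left coset W_I x) and ℓ(xv) ≤ ℓ(x) for all v ∈ W_J (x has maximal length in its right coset xW_J). Then the assignment x ↦ W_I x W_J is a bijection from X onto the set of free (W_I, W_J) double cosets in W. -/
namespace CoxeterSystem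

variable {B W : Type*} {M : CoxeterMatrix B} [Group W] (cs : CoxeterSystem M W)

/-- The standard parabolic subgroup generated by the simple reflections indexed by `J`. -/
abbrev parabolic (J : Set B) : Subgroup W := Subgroup.closure (cs.simple '' J)

open Classical in
/-- The involution of `W × ZMod 2` which conjugates the first coordinate by the `i`-th simple
reflection and flips the second one when the first one is that reflection. -/
noncomputable def signedConj (i : B) : Equiv.Perm (W × ZMod 2) :=
  Function.Involutive.toPerm
    (fun p => (cs.simple i * p.1 * cs.simple i, p.2 + if p.1 = cs.simple i then 1 else 0)) <| by
    rintro ⟨t, e⟩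
    have h : cs.simple i * t * cs.simple i = cs.simple i ↔ t = cs.simple i := by
      rw [mul_eq_right, mul_eq_one_iff_eq_inv', cs.inv_simple]
    ext
    · simp [mul_assoc]
    · simp only [h, add_assoc, CharTwo.add_self_eq_zero, add_zero]

open Classical in
theorem signedConj_apply (i : B) (p : W × ZMod 2) :
    cs.signedConj i p =
      (cs.simple i * p.1 * cs.simple i, p.2 + if p.1 = cs.simple i then 1 else 0) := rfl

theorem simple_mul_pow_eq (i j : B) (k : ℕ) :
    cs.simple j * (cs.simple i * cs.simple j) ^ k =
      ((cs.simple i * cs.simple j) ^ k)⁻¹ * cs.simple j := by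
  induction k with
  | zero => simp
  | succ k ih =>
    rw [pow_succ, ← mul_assoc, ih, ← pow_succ, pow_succ', mul_inv_rev, mul_inv_rev]
    simp only [inv_simple, mul_assoc]

open Classical in
theorem signedConj_mul_pow_apply (i j : B) (k : ℕ) (t : W) (e : ZMod 2) :
    ((cs.signedConj i * cs.signedConj j) ^ k) (t, e) =
      ((cs.simple i * cs.simple j) ^ k * t * ((cs.simple i * cs.simple j) ^ k)⁻¹,
        e + ∑ n ∈ Finset.range (2 * k),
          if t = cs.simple j * (cs.simple i * cs.simple j) ^ n then 1 else 0) := by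
  induction k with
  | zero => simp
  | succ k ih =>
    set p := cs.simple i * cs.simple j with hp
    have hj : cs.simple j * p ^ (2 * k) = (p ^ k)⁻¹ * cs.simple j * p ^ k := by
      rw [two_mul, pow_add, ← mul_assoc, cs.simple_mul_pow_eq]
    have hi : cs.simple j * p ^ (2 * k + 1) =
        (p ^ k)⁻¹ * (cs.simple j * cs.simple i * cs.simple j) * p ^ k := by
      rw [two_mul, add_assoc, pow_add, pow_succ', ← mul_assoc, cs.simple_mul_pow_eq, hp]
      simp only [mul_assoc]
    have h1 : p ^ k * t * (p ^ k)⁻¹ = cs.simple j ↔ t = cs.simple j * p ^ (2 * k) := by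
      rw [hj]
      constructor
      · rintro h; rw [← h]; group
      · rintro rfl; group
    have h2 : cs.simple j * (p ^ k * t * (p ^ k)⁻¹) * cs.simple j = cs.simple i ↔
        t = cs.simple j * p ^ (2 * k + 1) := by
      rw [hi]
      constructor
      · rintro h; rw [← h]; simp [mul_assoc]
      · rintro rfl; simp [mul_assoc]
    rw [pow_succ', Equiv.Perm.mul_apply, ih, Equiv.Perm.mul_apply, signedConj_apply,
      signedConj_apply, mul_add_one, Finset.sum_range_succ, Finset.sum_range_succ]
    simp only [h1, h2]
    ext
    · simp [hp, pow_succ', mul_assoc]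
    · simp [add_assoc]

theorem isLiftable_signedConj : M.IsLiftable cs.signedConj := by
  classical
  intro i j
  ext1 ⟨t, e⟩
  have hsum : ∑ n ∈ Finset.range (2 * M i j),
      (if t = cs.simple j * (cs.simple i * cs.simple j) ^ n then (1 : ZMod 2) else 0) = 0 := by
    rw [two_mul, Finset.sum_range_add]
    simp only [pow_add, cs.simple_mul_simple_pow, one_mul, CharTwo.add_self_eq_zero]
  rw [signedConj_mul_pow_apply, hsum]
  simp

/-- The action of `W` on `W × ZMod 2` extending `signedConj`. -/
noncomputable def signedAction : W →* Equiv.Perm (W × ZMod 2) :=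
  cs.lift ⟨cs.signedConj, cs.isLiftable_signedConj⟩

open Classical in
theorem signedAction_wordProd (ω : List B) (t : W) (e : ZMod 2) :
    cs.signedAction (cs.wordProd ω) (t, e) =
      (cs.wordProd ω * t * (cs.wordProd ω)⁻¹, e + ((cs.rightInvSeq ω).count t : ℕ)) := by
  induction ω with
  | nil => simp
  | cons i ω ih =>
    have h : cs.wordProd ω * t * (cs.wordProd ω)⁻¹ = cs.simple i ↔
        (cs.wordProd ω)⁻¹ * cs.simple i * cs.wordProd ω = t := by
      constructor
      · rintro h; rw [← h]; group
      · rintro rfl; group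
    have hs : cs.signedAction (cs.simple i) = cs.signedConj i :=
      cs.lift_apply_simple cs.isLiftable_signedConj i
    rw [wordProd_cons, map_mul, Equiv.Perm.mul_apply, ih, hs, signedConj_apply]
    simp only [h, rightInvSeq, List.count_cons, beq_iff_eq]
    ext
    · simp [mul_assoc]
    · push_cast
      rw [add_assoc]

/-- The exchange property. -/
theorem exists_eraseIdx_of_isRightDescent {ω : List B} {i : B}
    (h : cs.IsRightDescent (cs.wordProd ω) i) :
    ∃ j < ω.length, cs.wordProd ω * cs.simple i = cs.wordProd (ω.eraseIdx j) := by
  classical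
  obtain ⟨η, hη, hw⟩ := cs.exists_isReduced (cs.wordProd ω * cs.simple i)
  have hprod : cs.wordProd (η.concat i) = cs.wordProd ω := by
    rw [wordProd_concat, ← hw, simple_mul_simple_cancel_right]
  have hred : cs.IsReduced (η.concat i) := by
    rw [IsReduced, hprod, ← (cs.isRightDescent_iff.mp h), hw, hη.eq, List.length_concat]
  have hmem' : cs.simple i ∈ cs.rightInvSeq (η.concat i) := by
    rw [rightInvSeq_concat]
    simp
  have hcount := List.count_eq_one_of_mem hred.nodup_rightInvSeq hmem'
  have hmem : cs.simple i ∈ cs.rightInvSeq ω := by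
    by_contra hn
    have h1 := cs.signedAction_wordProd (η.concat i) (cs.simple i) 0
    rw [hprod, cs.signedAction_wordProd, hcount, List.count_eq_zero_of_not_mem hn] at h1
    simp at h1
  obtain ⟨j, hj, hjs⟩ := List.mem_iff_getElem.mp hmem
  refine ⟨j, by simpa using hj, ?_⟩
  rw [← wordProd_mul_getD_rightInvSeq, List.getD_eq_getElem _ _ hj, hjs]

theorem wordProd_mem_parabolic {J : Set B} {ω : List B} (h : ∀ i ∈ ω, i ∈ J) :
    cs.wordProd ω ∈ cs.parabolic J := by
  refine Subgroup.list_prod_mem _ fun x hx => ?_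
  obtain ⟨i, hi, rfl⟩ := List.mem_map.mp hx
  exact Subgroup.subset_closure ⟨i, h i hi, rfl⟩

theorem simple_mem_parabolic {J : Set B} {i : B} (hi : i ∈ J) : cs.simple i ∈ cs.parabolic J :=
  Subgroup.subset_closure ⟨i, hi, rfl⟩

/-- Every element of a standard parabolic subgroup has a reduced word in its generators. -/
theorem exists_isReduced_of_mem_parabolic {J : Set B} {v : W} (hv : v ∈ cs.parabolic J) :
    ∃ ω, cs.IsReduced ω ∧ (∀ i ∈ ω, i ∈ J) ∧ v = cs.wordProd ω := by
  have step : ∀ v : W, ∀ i ∈ J, (∃ ω, cs.IsReduced ω ∧ (∀ i ∈ ω, i ∈ J) ∧ v = cs.wordProd ω) →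
      ∃ ω, cs.IsReduced ω ∧ (∀ i ∈ ω, i ∈ J) ∧ v * cs.simple i = cs.wordProd ω := by
    rintro _ i hi ⟨ω, hω, hJ, rfl⟩
    by_cases h : cs.IsRightDescent (cs.wordProd ω) i
    · obtain ⟨j, hj, hprod⟩ := cs.exists_eraseIdx_of_isRightDescent h
      refine ⟨ω.eraseIdx j, ?_, fun k hk => hJ k (List.mem_of_mem_eraseIdx hk), hprod⟩
      have h1 := cs.isRightDescent_iff.mp h
      have h2 := List.length_eraseIdx_add_one hj
      rw [hω.eq] at h1
      rw [IsReduced, ← hprod]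
      omega
    · refine ⟨ω.concat i, ?_, ?_, (cs.wordProd_concat i ω).symm⟩
      · rw [IsReduced, wordProd_concat, cs.not_isRightDescent_iff.mp h, hω.eq, List.length_concat]
      · intro k hk
        rw [List.concat_eq_append, List.mem_append, List.mem_singleton] at hk
        rcases hk with hk | rfl
        exacts [hJ k hk, hi]
  induction hv using Subgroup.closure_induction_right with
  | one => exact ⟨[], by simp [IsReduced], by simp, by simp⟩
  | mul_right v _ y hy ih =>
    obtain ⟨i, hi, rfl⟩ := hy
    exact step v i hi ih
  | mul_inv_cancel v _ y hy ih =>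
    obtain ⟨i, hi, rfl⟩ := hy
    rw [inv_simple]
    exact step v i hi ih

/-- Induction along reduced words of elements of a standard parabolic subgroup. -/
theorem parabolic_induction {J : Set B} {p : W → Prop} (one : p 1)
    (mul_simple : ∀ v ∈ cs.parabolic J, ∀ i ∈ J, ¬cs.IsRightDescent v i → p v →
      p (v * cs.simple i)) {v : W} (hv : v ∈ cs.parabolic J) : p v := by
  obtain ⟨ω, hω, hJ, rfl⟩ := cs.exists_isReduced_of_mem_parabolic hv
  clear hv
  induction ω using List.reverseRecOn with
  | nil => simpa using one
  | append_singleton ω i ih =>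
    have hω' : cs.IsReduced ω := by simpa using hω.take ω.length
    have hJ' : ∀ k ∈ ω, k ∈ J := fun k hk => hJ k (by simp [hk])
    rw [wordProd_append, wordProd_singleton]
    refine mul_simple _ (cs.wordProd_mem_parabolic hJ') i (hJ i (by simp)) ?_ (ih hω' hJ')
    have h := hω.eq
    rw [wordProd_append, wordProd_singleton, List.length_append, List.length_singleton] at h
    rw [not_isRightDescent_iff, h, hω'.eq]

/-- The exchange property for a product of two elements, the first of which lies in a given
standard parabolic subgroup. -/
theorem exchange_mul_of_mem {K : Set B} {x y : W} {i : B} (hx : x ∈ cs.parabolic K)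
    (h : cs.IsRightDescent (x * y) i) :
    (∃ x' ∈ cs.parabolic K, cs.length x' < cs.length x ∧ x * y * cs.simple i = x' * y) ∨
      cs.IsRightDescent y i := by
  obtain ⟨ω, hω, hK, rfl⟩ := cs.exists_isReduced_of_mem_parabolic hx
  obtain ⟨η, hη, rfl⟩ := cs.exists_isReduced y
  rw [← wordProd_append] at h
  obtain ⟨j, hj, hprod⟩ := cs.exists_eraseIdx_of_isRightDescent h
  have hlt : ∀ (ζ : List B) (k : ℕ), cs.IsReduced ζ → k < ζ.length →
      cs.length (cs.wordProd (ζ.eraseIdx k)) < cs.length (cs.wordProd ζ) := by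
    intro ζ k hζ hk
    have h1 := List.length_eraseIdx_add_one hk
    have h2 := cs.length_wordProd_le (ζ.eraseIdx k)
    rw [hζ.eq]
    omega
  rcases lt_or_ge j ω.length with hjω | hjω
  · refine Or.inl ⟨cs.wordProd (ω.eraseIdx j), cs.wordProd_mem_parabolic fun k hk =>
      hK k (List.mem_of_mem_eraseIdx hk), hlt ω j hω hjω, ?_⟩
    rw [← wordProd_append, hprod, List.eraseIdx_append_of_lt_length hjω, wordProd_append]
  · rw [List.length_append] at hj
    rw [List.eraseIdx_append_of_length_le hjω, wordProd_append, wordProd_append, mul_assoc] at hprod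
    right
    rw [IsRightDescent, mul_left_cancel hprod]
    exact hlt η _ hη (by omega)

/-- The exchange property for a product of two elements, the second of which does not have the
given descent. -/
theorem exchange_mul_of_not_isRightDescent {x y : W} {i : B} (h : cs.IsRightDescent (x * y) i)
    (hy : ¬cs.IsRightDescent y i) :
    ∃ x', cs.length x' < cs.length x ∧ x * y * cs.simple i = x' * y := by
  have hx : x ∈ cs.parabolic Set.univ := by
    simp [parabolic, Set.image_univ, cs.subgroup_closure_range_simple]
  rcases cs.exchange_mul_of_mem hx h with ⟨x', -, hlt, heq⟩ | hy'
  · exact ⟨x', hlt, heq⟩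
  · exact absurd hy' hy

/-- Lengths add when multiplying a minimal coset representative by an element of the parabolic
subgroup. -/
theorem length_mul_of_minimal {J : Set B} {x : W}
    (hx : ∀ v ∈ cs.parabolic J, cs.length x ≤ cs.length (x * v)) {v : W}
    (hv : v ∈ cs.parabolic J) : cs.length (x * v) = cs.length x + cs.length v := by
  refine cs.parabolic_induction (p := fun v => cs.length (x * v) = cs.length x + cs.length v)
    (by simp) ?_ hv
  intro v hv i hi hvi ih
  have hxv : ¬cs.IsRightDescent (x * v) i := by
    intro h
    obtain ⟨x', hlt, heq⟩ := cs.exchange_mul_of_not_isRightDescent h hvi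
    have hx' : x' = x * (v * cs.simple i * v⁻¹) := by
      rw [← mul_assoc, ← mul_assoc, heq, mul_inv_cancel_right]
    have hmem : v * cs.simple i * v⁻¹ ∈ cs.parabolic J :=
      mul_mem (mul_mem hv (cs.simple_mem_parabolic hi)) (inv_mem hv)
    exact absurd (hx _ hmem) (by rw [← hx']; omega)
  rw [not_isRightDescent_iff] at hxv hvi
  rw [← mul_assoc, hxv, hvi, ih, add_assoc]

/-- An element without descents in `J` has minimal length in its coset. -/
theorem minimal_of_forall_not_isRightDescent {J : Set B} {x : W}
    (hx : ∀ i ∈ J, ¬cs.IsRightDescent x i) :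
    ∀ v ∈ cs.parabolic J, cs.length x ≤ cs.length (x * v) := by
  obtain ⟨m, ⟨u, hu, rfl⟩, hm⟩ := exists_minimalFor_of_wellFoundedLT
    (fun m => ∃ u ∈ cs.parabolic J, m = x * u) cs.length ⟨x, 1, one_mem _, by simp⟩
  have hmin : ∀ v ∈ cs.parabolic J, cs.length (x * u) ≤ cs.length (x * u * v) := by
    intro v hv
    by_contra! hlt
    exact absurd (hm ⟨u * v, mul_mem hu hv, by rw [mul_assoc]⟩ hlt.le) hlt.not_ge
  suffices u = 1 by simpa [this] using hmin
  by_contra hne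
  obtain ⟨ω, hω, hJ, hprod⟩ := cs.exists_isReduced_of_mem_parabolic (inv_mem hu)
  rcases List.eq_nil_or_concat ω with rfl | ⟨η, i, rfl⟩
  · simp [hne] at hprod
  have hi : i ∈ J := hJ i (by simp)
  have hη : cs.wordProd η ∈ cs.parabolic J :=
    cs.wordProd_mem_parabolic fun k hk => hJ k (by simp [hk])
  refine hx i hi ?_
  have h1 := cs.length_mul_of_minimal hmin (inv_mem hu)
  have h2 := cs.length_mul_of_minimal hmin hη
  have h3 : x * cs.simple i = x * u * cs.wordProd η := by
    rw [wordProd_concat] at hprod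
    rw [← cs.simple_mul_simple_cancel_right (w := cs.wordProd η) i, ← hprod]
    group
  have h4 := cs.length_wordProd_le η
  rw [mul_inv_cancel_right, hprod, hω.eq, List.length_concat] at h1
  rw [IsRightDescent, h3, h2]
  omega

/-- Lengths subtract when dividing a maximal coset representative by an element of the parabolic
subgroup. -/
theorem length_mul_inv_add_length_le {J : Set B} {x : W}
    (hx : ∀ i ∈ J, cs.IsRightDescent x i) {v : W} (hv : v ∈ cs.parabolic J) :
    cs.length (x * v⁻¹) + cs.length v ≤ cs.length x := by
  refine cs.parabolic_induction
    (p := fun v => cs.length (x * v⁻¹) + cs.length v ≤ cs.length x) (by simp) ?_ hv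
  intro v _ i hi hvi ih
  have h : cs.IsRightDescent (x * v⁻¹ * v) i := by simpa using hx i hi
  obtain ⟨y, hlt, heq⟩ := cs.exchange_mul_of_not_isRightDescent h hvi
  have hy : x * (v * cs.simple i)⁻¹ = y := by
    rw [eq_mul_inv_of_mul_eq heq.symm, mul_inv_rev, inv_simple, inv_mul_cancel_right, mul_assoc]
  rw [hy, cs.not_isRightDescent_iff.mp hvi]
  omega

theorem isRightDescent_of_maximal {J : Set B} {x : W}
    (hx : ∀ v ∈ cs.parabolic J, cs.length (x * v) ≤ cs.length x) {i : B} (hi : i ∈ J) :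
    cs.IsRightDescent x i :=
  lt_of_le_of_ne (hx _ (cs.simple_mem_parabolic hi)) (cs.length_mul_simple_ne x i)

/-- Coset representatives of maximal length are unique. -/
theorem eq_one_of_maximal {J : Set B} {x v : W}
    (hx : ∀ v ∈ cs.parabolic J, cs.length (x * v) ≤ cs.length x) (hv : v ∈ cs.parabolic J)
    (hxv : cs.length x ≤ cs.length (x * v)) : v = 1 := by
  have h := cs.length_mul_inv_add_length_le (fun i hi => cs.isRightDescent_of_maximal hx hi)
    (inv_mem hv)
  rw [inv_inv, length_inv] at h
  exact cs.length_eq_zero_iff.mp (by omega)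

/-- Left-handed version of `length_mul_of_minimal`. -/
theorem length_mul_of_minimal_left {I : Set B} {x : W}
    (hx : ∀ u ∈ cs.parabolic I, cs.length x ≤ cs.length (u * x)) {u : W}
    (hu : u ∈ cs.parabolic I) : cs.length (u * x) = cs.length u + cs.length x := by
  have hx' : ∀ v ∈ cs.parabolic I, cs.length x⁻¹ ≤ cs.length (x⁻¹ * v) := by
    intro v hv
    have h := hx v⁻¹ (inv_mem hv)
    rwa [← cs.length_inv x, ← cs.length_inv (v⁻¹ * x), mul_inv_rev, inv_inv] at h
  have h := cs.length_mul_of_minimal hx' (inv_mem hu)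
  rwa [← mul_inv_rev, length_inv, length_inv, length_inv, add_comm] at h

/-- In a free double coset with minimal representative `d`, each `a * d` with `a ∈ W_I` has
minimal length in its coset `a * d * W_J`. -/
theorem minimal_mul_of_free {I J : Set B} {d : W}
    (hd : ∀ v ∈ cs.parabolic J, cs.length d ≤ cs.length (d * v))
    (hfree : ∀ a ∈ cs.parabolic I, ∀ b ∈ cs.parabolic J, a * d = d * b → b = 1)
    {a : W} (ha : a ∈ cs.parabolic I) :
    ∀ v ∈ cs.parabolic J, cs.length (a * d) ≤ cs.length (a * d * v) := by
  refine cs.minimal_of_forall_not_isRightDescent fun i hi h => ?_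
  have hs := cs.simple_mem_parabolic hi
  rcases cs.exchange_mul_of_mem ha h with ⟨a', ha', -, heq⟩ | hlt
  · have h1 := hfree _ (mul_mem (inv_mem ha) ha') _ hs
      (by rw [mul_assoc, ← heq]; group)
    simpa [h1] using cs.length_simple i
  · exact absurd (hd _ hs) (not_le_of_gt hlt)

/-- In a free double coset with minimal representative `d`, each `d * b` with `b ∈ W_J` has
minimal length in its coset `W_I * d * b`. -/
theorem minimal_mul_of_free_left {I J : Set B} {d : W}
    (hd : ∀ u ∈ cs.parabolic I, cs.length d ≤ cs.length (u * d))
    (hfree : ∀ a ∈ cs.parabolic I, ∀ b ∈ cs.parabolic J, a * d = d * b → a = 1)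
    {b : W} (hb : b ∈ cs.parabolic J) :
    ∀ u ∈ cs.parabolic I, cs.length (d * b) ≤ cs.length (u * (d * b)) := by
  intro u hu
  have h := cs.minimal_mul_of_free (I := J) (J := I) (d := d⁻¹) ?_ ?_ (inv_mem hb) _ (inv_mem hu)
  · rwa [← mul_inv_rev, ← mul_inv_rev, length_inv, length_inv] at h
  · intro v hv
    have h := hd _ (inv_mem hv)
    rwa [← cs.length_inv d, ← cs.length_inv (v⁻¹ * d), mul_inv_rev, inv_inv] at h
  · intro b hb a ha h
    have hdb : a * d = d * b := by
      calc a * d = d * (d⁻¹ * a) * d := by group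
        _ = d * b := by rw [← h]; group
    exact hfree a ha b hb hdb

/-- In a free double coset, a representative `d` of minimal length satisfies
`ℓ (a * d * b) = ℓ a + ℓ (d * b)` for all `a ∈ W_I` and `b ∈ W_J`. -/
theorem exists_length_mul_of_free {I J : Set B} {w : W}
    (hfree : ∀ a ∈ cs.parabolic I, ∀ b ∈ cs.parabolic J, a * w = w * b → a = 1) :
    ∃ a₀ ∈ cs.parabolic I, ∃ b₀ ∈ cs.parabolic J,
      ∀ a ∈ cs.parabolic I, ∀ b ∈ cs.parabolic J,
        cs.length (a * (a₀ * w * b₀ * b)) = cs.length a + cs.length (a₀ * w * b₀ * b) := by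
  obtain ⟨d, ⟨a₀, ha₀, b₀, hb₀, rfl⟩, hmin⟩ := exists_minimalFor_of_wellFoundedLT
    (fun d => ∃ a ∈ cs.parabolic I, ∃ b ∈ cs.parabolic J, d = a * w * b) cs.length
    ⟨w, 1, one_mem _, 1, one_mem _, by simp⟩
  refine ⟨a₀, ha₀, b₀, hb₀, fun a ha b hb => cs.length_mul_of_minimal_left
    (cs.minimal_mul_of_free_left (I := I) (J := J) ?_ ?_ hb) ha⟩
  · intro u hu
    by_contra! hlt
    exact absurd (hmin ⟨u * a₀, mul_mem hu ha₀, b₀, hb₀, by simp only [mul_assoc]⟩ hlt.le)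
      hlt.not_ge
  · intro a ha b hb h
    have h1 := hfree (a₀⁻¹ * a * a₀) (mul_mem (mul_mem (inv_mem ha₀) ha) ha₀)
      (b₀ * b * b₀⁻¹) (mul_mem (mul_mem hb₀ hb) (inv_mem hb₀)) (by
        calc a₀⁻¹ * a * a₀ * w = a₀⁻¹ * (a * (a₀ * w * b₀)) * b₀⁻¹ := by group
          _ = w * (b₀ * b * b₀⁻¹) := by rw [h]; group)
    simpa [mul_assoc, inv_mul_eq_one] using h1

end CoxeterSystem

theorem Subgroup.injective_mul_mul_iff {G : Type*} [Group G] (P Q : Subgroup G) (w : G) :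
    Function.Injective (fun p : P × Q => (p.1 : G) * w * (p.2 : G)) ↔
      ∀ a ∈ P, ∀ b ∈ Q, a * w = w * b → a = 1 := by
  constructor
  · intro h a ha b hb hab
    have := @h (⟨a, ha⟩, 1) (1, ⟨b, hb⟩) (by simpa using hab)
    simpa using congrArg (fun p => (p.1 : G)) this
  · rintro h ⟨⟨a, ha⟩, b, hb⟩ ⟨⟨a', ha'⟩, b', hb'⟩ hab
    have hab : a * w * b = a' * w * b' := hab
    have h1 := h (a'⁻¹ * a) (mul_mem (inv_mem ha') ha) (b' * b⁻¹) (mul_mem hb' (inv_mem hb)) (by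
      calc a'⁻¹ * a * w = a'⁻¹ * (a * w * b) * b⁻¹ := by group
        _ = w * (b' * b⁻¹) := by rw [hab]; group)
    obtain rfl := inv_mul_eq_one.mp h1
    simpa using hab

theorem Subgroup.setOf_mul_mul_eq {G : Type*} [Group G] (P Q : Subgroup G) {x a b : G}
    (ha : a ∈ P) (hb : b ∈ Q) :
    {z : G | ∃ c ∈ P, ∃ d ∈ Q, z = c * (a * x * b) * d} =
      {z : G | ∃ c ∈ P, ∃ d ∈ Q, z = c * x * d} := by
  ext z
  constructor
  · rintro ⟨c, hc, d, hd, rfl⟩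
    exact ⟨c * a, mul_mem hc ha, b * d, mul_mem hb hd, by simp only [mul_assoc]⟩
  · rintro ⟨c, hc, d, hd, rfl⟩
    exact ⟨c * a⁻¹, mul_mem hc (inv_mem ha), b⁻¹ * d, mul_mem (inv_mem hb) hd, by group⟩


/-- Let `(W,S)` be a finite Coxeter system and `I, J ⊆ S` (encoded by sets of indices `I, J ⊆ B`,
with `W_I = ⟨I⟩`, `W_J = ⟨J⟩` the standard parabolic subgroups).  Let `X` be the set of `x ∈ W`
of minimal length in the left coset `W_I x` and of maximal length in the right coset `x W_J`.
Then `x ↦ W_I x W_J` is a bijection from `X` onto the set of free `(W_I, W_J)` double cosets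
in `W`. -/
theorem stmt2 {B : Type} {M : CoxeterMatrix B} {W : Type} [Group W] [Finite W]
    (cs : CoxeterSystem M W) (I J : Set B) :
    Set.BijOn
      (fun x : W => {w : W | ∃ a ∈ Subgroup.closure (cs.simple '' I),
          ∃ b ∈ Subgroup.closure (cs.simple '' J), w = a * x * b})
      {x : W |
        (∀ u ∈ Subgroup.closure (cs.simple '' I), cs.length x ≤ cs.length (u * x)) ∧
        (∀ v ∈ Subgroup.closure (cs.simple '' J), cs.length (x * v) ≤ cs.length x)}
      {C : Set W | ∃ w : W,
        C = {z : W | ∃ a ∈ Subgroup.closure (cs.simple '' I),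
            ∃ b ∈ Subgroup.closure (cs.simple '' J), z = a * w * b} ∧
        Function.Injective
          (fun p : ↥(Subgroup.closure (cs.simple '' I)) × ↥(Subgroup.closure (cs.simple '' J)) =>
            (p.1 : W) * w * (p.2 : W))} := by
  simp only [Subgroup.injective_mul_mul_iff]
  have hfree : ∀ x : W, (∀ u ∈ cs.parabolic I, cs.length x ≤ cs.length (u * x)) →
      (∀ v ∈ cs.parabolic J, cs.length (x * v) ≤ cs.length x) →
      ∀ a ∈ cs.parabolic I, ∀ b ∈ cs.parabolic J, a * x = x * b → a = 1 := by
    intro x hmin hmax a ha b hb h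
    have h1 := cs.length_mul_of_minimal_left hmin ha
    have h2 := hmax b hb
    rw [← h] at h2
    exact cs.length_eq_zero_iff.mp (by omega)
  refine ⟨fun x hx => ⟨x, rfl, hfree x hx.1 hx.2⟩, ?_, ?_⟩
  · intro x hx y hy hxy
    obtain ⟨a₀, ha₀, b₀, hb₀, hadd⟩ := cs.exists_length_mul_of_free (hfree x hx.1 hx.2)
    set d := a₀ * x * b₀ with hd
    have hrep : ∀ z : W, (∀ u ∈ cs.parabolic I, cs.length z ≤ cs.length (u * z)) →
        ∀ a ∈ cs.parabolic I, ∀ b ∈ cs.parabolic J, z = a * (d * b) → z = d * b := by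
      intro z hz a ha b hb h
      have h1 := hadd a ha b hb
      have h2 := hz a⁻¹ (inv_mem ha)
      rw [← h] at h1
      rw [inv_mul_eq_iff_eq_mul.mpr h] at h2
      have ha1 : a = 1 := cs.length_eq_zero_iff.mp (by omega)
      rw [h, ha1, one_mul]
    obtain ⟨a, ha, b, hb, hyx⟩ : ∃ a ∈ cs.parabolic I, ∃ b ∈ cs.parabolic J, y = a * x * b := by
      have hy' : y ∈ {w : W | ∃ a ∈ cs.parabolic I, ∃ b ∈ cs.parabolic J, w = a * y * b} :=
        ⟨1, one_mem _, 1, one_mem _, by simp⟩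
      exact (Set.ext_iff.mp hxy y).mpr hy'
    have hxd := hrep x hx.1 a₀⁻¹ (inv_mem ha₀) b₀⁻¹ (inv_mem hb₀) (by rw [hd]; group)
    have hyd := hrep y hy.1 (a * a₀⁻¹) (mul_mem ha (inv_mem ha₀)) (b₀⁻¹ * b)
      (mul_mem (inv_mem hb₀) hb) (by rw [hyx, hd]; group)
    have hyb : y = x * b := by rw [hyd, ← mul_assoc, ← hxd]
    have hxb : x = y * b⁻¹ := by rw [hyb, mul_inv_cancel_right]
    have hb1 : b = 1 := cs.eq_one_of_maximal hx.2 hb (by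
      rw [← hyb]
      conv_lhs => rw [hxb]
      exact hy.2 _ (inv_mem hb))
    rw [hyb, hb1, mul_one]
  · rintro _ ⟨w, rfl, hw⟩
    obtain ⟨a₀, ha₀, b₀, hb₀, hadd⟩ := cs.exists_length_mul_of_free hw
    obtain ⟨⟨b, hb⟩, hmax⟩ :=
      Finite.exists_max fun b : cs.parabolic J => cs.length (a₀ * w * b₀ * b)
    refine ⟨a₀ * w * (b₀ * b), ⟨fun u hu => ?_, fun v hv => ?_⟩,
      Subgroup.setOf_mul_mul_eq _ _ ha₀ (mul_mem hb₀ hb)⟩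
    · rw [← mul_assoc _ b₀, hadd u hu b hb]
      exact Nat.le_add_left _ _
    · have h := hmax ⟨b * v, mul_mem hb hv⟩
      simpa only [mul_assoc] using h
end

section
/- Let Φ be a finite reduced crystallographic root system with Weyl group W, and fix a base Σ ⊆ Φ with associated positive system Φ⁺. Let Σ_L, Σ_M ⊆ Σ, let Φ_L (resp. Φ_M) be the set of roots lying in the ℤ-span of Σ_L (resp. Σ_M), let W_L (resp. W_M) be the subgroup of W generated by the reflections s_α with α ∈ Σ_L (resp. α ∈ Σ_M), and set Φ_𝔭 = Φ⁺ ∪ Φ_L and Φ_M⁺ = Φ_M ∩ Φ⁺. Then: (i) for w ∈ W the condition w(Φ_𝔭) ∩ Φ_M = Φ_M⁺ depends only on the coset wW_L; and (ii) the assignment wW_L ↦ W_M w W_L is a bijection from the set {wW_L ∈ W/W_L : w(Φ_𝔭) ∩ Φ_M = Φ_M⁺} onto the set of free (W_M, W_L) double cosets in W. -/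
/-- A finite reduced root system with a choice of base, presented through the coordinates of
vectors with respect to the base. -/
structure BasedRootSystem (V : Type*) [AddCommGroup V] [Module ℝ V] where
  root : Set V
  finite_root : root.Finite
  span_root : Submodule.span ℝ root = ⊤
  coroot : V → (V →ₗ[ℝ] ℝ)
  coroot_self : ∀ α ∈ root, coroot α α = 2
  refl : V → (V ≃ₗ[ℝ] V)
  refl_apply : ∀ α ∈ root, ∀ x : V, refl α x = x - coroot α x • α
  refl_mem : ∀ α ∈ root, ∀ β ∈ root, refl α β ∈ root
  reduced : ∀ α ∈ root, ∀ c : ℝ, c • α ∈ root → c = 1 ∨ c = -1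
  base : Finset V
  base_subset : ∀ α ∈ base, α ∈ root
  coord : V → (V →ₗ[ℝ] ℝ)
  coord_self : ∀ α ∈ base, coord α α = 1
  coord_of_ne : ∀ α ∈ base, ∀ β ∈ base, α ≠ β → coord α β = 0
  sum_coord : ∀ x : V, ∑ α ∈ base, coord α x • α = x
  coord_sign : ∀ β ∈ root, (∀ α ∈ base, 0 ≤ coord α β) ∨ (∀ α ∈ base, coord α β ≤ 0)

namespace BasedRootSystem

variable {V : Type*} [AddCommGroup V] [Module ℝ V] (R : BasedRootSystem V)

/-- The positive roots. -/
def Pos (β : V) : Prop := β ∈ R.root ∧ ∀ α ∈ R.base, 0 ≤ R.coord α β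

/-- The roots supported on a subset `D` of the base. -/
def levi (D : Finset V) : Set V := {β ∈ R.root | ∀ α ∈ R.base, α ∉ D → R.coord α β = 0}

/-- The roots of the standard parabolic attached to a subset `D` of the base. -/
def parabolic (D : Finset V) : Set V :=
  {β ∈ R.root | ∀ α ∈ R.base, α ∉ D → 0 ≤ R.coord α β}

/-- The subgroup generated by the reflections in a set of vectors. -/
def reflGroup (D : Set V) : Subgroup (V ≃ₗ[ℝ] V) := Subgroup.closure (R.refl '' D)

/-- The condition `w (Φ_𝔭) ∩ Φ_M = Φ_M⁺`. -/
def Adapted (L M : Finset V) (w : V ≃ₗ[ℝ] V) : Prop :=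
  ∀ β ∈ R.levi M, (w⁻¹ β ∈ R.parabolic L ↔ R.Pos β)

lemma apply_inv_apply (w : V ≃ₗ[ℝ] V) (x : V) : w (w⁻¹ x) = x := w.apply_symm_apply x

lemma inv_apply_apply (w : V ≃ₗ[ℝ] V) (x : V) : w⁻¹ (w x) = x := w.symm_apply_apply x

lemma refl_self {α : V} (hα : α ∈ R.root) : R.refl α α = -α := by
  rw [R.refl_apply α hα, R.coroot_self α hα, two_smul]; abel

lemma refl_refl {α : V} (hα : α ∈ R.root) (x : V) : R.refl α (R.refl α x) = x := by
  rw [R.refl_apply α hα x, map_sub, map_smul, R.refl_self hα, R.refl_apply α hα x]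
  simp

lemma refl_mul_self {α : V} (hα : α ∈ R.root) : R.refl α * R.refl α = 1 :=
  LinearEquiv.ext fun x => R.refl_refl hα x

lemma refl_inv {α : V} (hα : α ∈ R.root) : (R.refl α)⁻¹ = R.refl α :=
  inv_eq_of_mul_eq_one_left (R.refl_mul_self hα)

lemma neg_mem {β : V} (hβ : β ∈ R.root) : -β ∈ R.root := by
  rw [← R.refl_self hβ]; exact R.refl_mem β hβ β hβ

lemma refl_ne_one {α : V} (hα : α ∈ R.root) : R.refl α ≠ 1 := by
  intro h
  have h1 : R.refl α α = α := by rw [h]; rfl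
  have h2 : R.coroot α (R.refl α α) = -2 := by rw [R.refl_self hα, map_neg, R.coroot_self α hα]
  rw [h1, R.coroot_self α hα] at h2
  norm_num at h2

variable {R}

/-- Membership in a reflection group is built by left multiplication by reflections. -/
lemma reflGroup_induction {D : Set V} (hD : D ⊆ R.root) {p : (V ≃ₗ[ℝ] V) → Prop}
    (one : p 1) (mul : ∀ α ∈ D, ∀ g, p g → p (R.refl α * g)) {w : V ≃ₗ[ℝ] V}
    (hw : w ∈ R.reflGroup D) : p w := by
  induction hw using Subgroup.closure_induction_left with
  | one => exact one
  | mul_left x hx y _ h =>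
    obtain ⟨α, hα, rfl⟩ := hx
    exact mul α hα _ h
  | inv_mul_cancel x hx y _ h =>
    obtain ⟨α, hα, rfl⟩ := hx
    rw [R.refl_inv (hD hα)]
    exact mul α hα _ h

lemma apply_mem_of_mem_reflGroup {D : Set V} (hD : D ⊆ R.root) {S : Set V}
    (hS : ∀ α ∈ D, ∀ β ∈ S, R.refl α β ∈ S) {w : V ≃ₗ[ℝ] V} (hw : w ∈ R.reflGroup D)
    {β : V} (hβ : β ∈ S) : w β ∈ S := by
  refine reflGroup_induction hD (p := fun w => w β ∈ S) hβ (fun α hα g hg => ?_) hw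
  exact hS α hα _ hg

lemma apply_mem_root {w : V ≃ₗ[ℝ] V} (hw : w ∈ R.reflGroup R.root) {β : V} (hβ : β ∈ R.root) :
    w β ∈ R.root :=
  apply_mem_of_mem_reflGroup subset_rfl R.refl_mem hw hβ

lemma reflGroup_mono {D E : Set V} (h : D ⊆ E) : R.reflGroup D ≤ R.reflGroup E :=
  Subgroup.closure_mono (Set.image_mono h)

lemma refl_mem_reflGroup {D : Set V} {α : V} (hα : α ∈ D) : R.refl α ∈ R.reflGroup D :=
  Subgroup.subset_closure ⟨α, hα, rfl⟩

/-- A coroot is determined by its root, so conjugation transports reflections. -/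
lemma coroot_apply {w : V ≃ₗ[ℝ] V} (hw : w ∈ R.reflGroup R.root) {α : V} (hα : α ∈ R.root)
    (x : V) : R.coroot (w α) (w x) = R.coroot α x := by
  have hwα := apply_mem_root hw hα
  have hinv := inv_mem hw
  have key : R.coroot (w α) = R.coroot α ∘ₗ (w⁻¹ : V ≃ₗ[ℝ] V).toLinearMap := by
    refine Module.Dual.eq_of_preReflection_mapsTo (x := w α) (Φ := R.root) R.finite_root
      R.span_root (R.coroot_self _ hwα) ?_ ?_ ?_
    · intro β hβ
      have := R.refl_mem _ hwα β hβ
      rw [R.refl_apply _ hwα] at this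
      simpa [Module.preReflection_apply] using this
    · simpa using R.coroot_self α hα
    · intro β hβ
      have := apply_mem_root hw (R.refl_mem _ hα _ (apply_mem_root hinv hβ))
      rw [R.refl_apply _ hα, map_sub, map_smul, apply_inv_apply] at this
      simpa [Module.preReflection_apply] using this
  rw [key]
  simp

lemma refl_apply_mul {w : V ≃ₗ[ℝ] V} (hw : w ∈ R.reflGroup R.root) {α : V} (hα : α ∈ R.root) :
    R.refl (w α) * w = w * R.refl α := by
  ext x
  change R.refl (w α) (w x) = w (R.refl α x)
  rw [R.refl_apply _ (apply_mem_root hw hα), R.refl_apply _ hα, coroot_apply hw hα, map_sub,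
    map_smul]

/-! ### Positive roots and simple reflections -/

lemma coord_refl_of_ne {α γ : V} (hα : α ∈ R.base) (hγ : γ ∈ R.base) (h : γ ≠ α) (x : V) :
    R.coord γ (R.refl α x) = R.coord γ x := by
  rw [R.refl_apply _ (R.base_subset α hα), map_sub, map_smul, R.coord_of_ne γ hγ α hα h]
  simp

lemma ne_zero_of_mem_root {β : V} (hβ : β ∈ R.root) : β ≠ 0 := by
  rintro rfl
  have := R.coroot_self 0 hβ
  simp at this

lemma pos_or_pos_neg {β : V} (hβ : β ∈ R.root) : R.Pos β ∨ R.Pos (-β) :=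
  (R.coord_sign β hβ).imp (fun h => ⟨hβ, h⟩)
    fun h => ⟨R.neg_mem hβ, fun α hα => by simpa using h α hα⟩

lemma Pos.not_neg {β : V} (hβ : R.Pos β) : ¬ R.Pos (-β) := by
  intro h
  refine ne_zero_of_mem_root hβ.1 ?_
  rw [← R.sum_coord β]
  refine Finset.sum_eq_zero fun α hα => ?_
  have h1 := hβ.2 α hα
  have h2 := h.2 α hα
  rw [map_neg] at h2
  rw [show R.coord α β = 0 by linarith, zero_smul]

lemma pos_of_mem_base {α : V} (hα : α ∈ R.base) : R.Pos α := by
  refine ⟨R.base_subset α hα, fun γ hγ => ?_⟩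
  by_cases h : γ = α
  · subst h; rw [R.coord_self γ hγ]; exact zero_le_one
  · rw [R.coord_of_ne γ hγ α hα h]

lemma Pos.refl {α β : V} (hα : α ∈ R.base) (hβ : R.Pos β) (hne : β ≠ α) :
    R.Pos (R.refl α β) := by
  refine (pos_or_pos_neg (R.refl_mem α (R.base_subset α hα) β hβ.1)).resolve_right fun h => ?_
  have hβα : β = R.coord α β • α := by
    conv_lhs => rw [← R.sum_coord β]
    refine Finset.sum_eq_single_of_mem α hα fun γ hγ hγα => ?_
    have h1 := hβ.2 γ hγ
    have h2 := h.2 γ hγ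
    rw [map_neg, coord_refl_of_ne hα hγ hγα] at h2
    rw [show R.coord γ β = 0 by linarith, zero_smul]
  have hmem := hβ.1
  rw [hβα] at hmem
  rcases R.reduced α (R.base_subset α hα) _ hmem with h1 | h1
  · rw [h1, one_smul] at hβα
    exact hne hβα
  · have := hβ.2 α hα
    linarith

lemma refl_mem_levi {D : Finset V} (hD : D ⊆ R.base) {α : V} (hα : α ∈ D) {β : V}
    (hβ : β ∈ R.levi D) : R.refl α β ∈ R.levi D := by
  refine ⟨R.refl_mem α (R.base_subset α (hD hα)) β hβ.1, fun γ hγ hγD => ?_⟩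
  rw [coord_refl_of_ne (hD hα) hγ (by rintro rfl; exact hγD hα)]
  exact hβ.2 γ hγ hγD

lemma refl_mem_parabolic {D : Finset V} (hD : D ⊆ R.base) {α : V} (hα : α ∈ D) {β : V}
    (hβ : β ∈ R.parabolic D) : R.refl α β ∈ R.parabolic D := by
  refine ⟨R.refl_mem α (R.base_subset α (hD hα)) β hβ.1, fun γ hγ hγD => ?_⟩
  rw [coord_refl_of_ne (hD hα) hγ (by rintro rfl; exact hγD hα)]
  exact hβ.2 γ hγ hγD

lemma subset_root_of_subset_base {D : Finset V} (hD : D ⊆ R.base) : (D : Set V) ⊆ R.root :=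
  fun α hα => R.base_subset α (hD hα)

lemma apply_mem_levi {D : Finset V} (hD : D ⊆ R.base) {w : V ≃ₗ[ℝ] V}
    (hw : w ∈ R.reflGroup D) {β : V} (hβ : β ∈ R.levi D) : w β ∈ R.levi D :=
  apply_mem_of_mem_reflGroup (subset_root_of_subset_base hD)
    (fun _ hα _ h => refl_mem_levi hD hα h) hw hβ

lemma apply_mem_parabolic {D : Finset V} (hD : D ⊆ R.base) {w : V ≃ₗ[ℝ] V}
    (hw : w ∈ R.reflGroup D) {β : V} (hβ : β ∈ R.parabolic D) : w β ∈ R.parabolic D :=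
  apply_mem_of_mem_reflGroup (subset_root_of_subset_base hD)
    (fun _ hα _ h => refl_mem_parabolic hD hα h) hw hβ

lemma mem_levi_of_mem {D : Finset V} (hD : D ⊆ R.base) {α : V} (hα : α ∈ D) : α ∈ R.levi D :=
  ⟨R.base_subset α (hD hα), fun γ hγ hγD =>
    R.coord_of_ne γ hγ α (hD hα) (by rintro rfl; exact hγD hα)⟩

lemma neg_mem_levi {D : Finset V} {β : V} (hβ : β ∈ R.levi D) : -β ∈ R.levi D :=
  ⟨R.neg_mem hβ.1, fun γ hγ hγD => by rw [map_neg, hβ.2 γ hγ hγD, neg_zero]⟩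

lemma mem_parabolic_or_neg (D : Finset V) {β : V} (hβ : β ∈ R.root) :
    β ∈ R.parabolic D ∨ -β ∈ R.parabolic D :=
  (pos_or_pos_neg hβ).imp (fun h => ⟨h.1, fun γ hγ _ => h.2 γ hγ⟩)
    fun h => ⟨h.1, fun γ hγ _ => h.2 γ hγ⟩

lemma mem_levi_of_parabolic {D : Finset V} {β : V} (hβ : β ∈ R.parabolic D)
    (hβ' : -β ∈ R.parabolic D) : β ∈ R.levi D := by
  refine ⟨hβ.1, fun γ hγ hγD => ?_⟩
  have h1 := hβ.2 γ hγ hγD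
  have h2 := hβ'.2 γ hγ hγD
  rw [map_neg] at h2
  linarith

/-! ### The exchange property -/

lemma prod_mem_reflGroup {D : Set V} {l : List V} (hl : ∀ γ ∈ l, γ ∈ D) :
    (l.map R.refl).prod ∈ R.reflGroup D := by
  refine Subgroup.list_prod_mem _ fun x hx => ?_
  obtain ⟨γ, hγ, rfl⟩ := List.mem_map.1 hx
  exact refl_mem_reflGroup (hl γ hγ)

lemma exchange {D : Finset V} (hD : D ⊆ R.base) {α : V} (hα : α ∈ R.base) (l : List V)
    (hl : ∀ γ ∈ l, γ ∈ D) (hneg : ¬ R.Pos ((l.map R.refl).prod α)) :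
    ∃ l' : List V, (∀ γ ∈ l', γ ∈ D) ∧ l'.length + 1 = l.length ∧
      (l'.map R.refl).prod = (l.map R.refl).prod * R.refl α := by
  induction l with
  | nil => exact absurd (pos_of_mem_base hα) hneg
  | cons β l ih =>
    have hlD : ∀ γ ∈ l, γ ∈ D := fun γ hγ => hl γ (List.mem_cons_of_mem _ hγ)
    have hβ : β ∈ D := hl β List.mem_cons_self
    by_cases hpos : R.Pos ((l.map R.refl).prod α)
    · have heq : (l.map R.refl).prod α = β := by
        by_contra hne
        exact hneg (by simpa using hpos.refl (hD hβ) hne)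
      refine ⟨l, hlD, rfl, ?_⟩
      have hw : (l.map R.refl).prod ∈ R.reflGroup R.root :=
        reflGroup_mono (subset_root_of_subset_base hD) (prod_mem_reflGroup hlD)
      have hconj := refl_apply_mul hw (R.base_subset α hα)
      rw [heq] at hconj
      rw [List.map_cons, List.prod_cons, mul_assoc, ← hconj, ← mul_assoc,
        R.refl_mul_self (R.base_subset β (hD hβ)), one_mul]
    · obtain ⟨l', hl', hlen, hprod⟩ := ih hlD hpos
      refine ⟨β :: l', ?_, by simp [hlen], ?_⟩
      · simpa [hβ] using hl'
      · rw [List.map_cons, List.prod_cons, hprod, List.map_cons, List.prod_cons, mul_assoc]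

lemma exists_list_of_mem_reflGroup {D : Set V} (hD : D ⊆ R.root) {w : V ≃ₗ[ℝ] V}
    (hw : w ∈ R.reflGroup D) : ∃ l : List V, (∀ γ ∈ l, γ ∈ D) ∧ (l.map R.refl).prod = w := by
  refine reflGroup_induction hD (p := fun w => ∃ l : List V, (∀ γ ∈ l, γ ∈ D) ∧
    (l.map R.refl).prod = w) ⟨[], by simp, rfl⟩ ?_ hw
  rintro α hα g ⟨l, hl, rfl⟩
  exact ⟨α :: l, by simpa [hα] using hl, by simp⟩

/-- An element of a standard parabolic subgroup which preserves the positive roots of the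
corresponding Levi subsystem is trivial. -/
lemma eq_one_of_preserves_pos {D : Finset V} (hD : D ⊆ R.base) {w : V ≃ₗ[ℝ] V}
    (hw : w ∈ R.reflGroup D) (hpos : ∀ β ∈ R.levi D, R.Pos β → R.Pos (w β)) : w = 1 := by
  obtain ⟨l, hl, rfl⟩ := exists_list_of_mem_reflGroup (subset_root_of_subset_base hD) hw
  clear hw
  induction hn : l.length using Nat.strong_induction_on generalizing l with
  | _ n ih =>
    subst hn
    rcases List.eq_nil_or_concat l with rfl | ⟨m, α, rfl⟩
    · rfl
    · simp only [List.concat_eq_append, List.mem_append, List.mem_singleton, List.map_append,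
        List.map_cons, List.map_nil, List.prod_append, List.prod_singleton, List.length_append,
        List.length_singleton] at hl hpos ih ⊢
      have hα : α ∈ D := hl α (Or.inr rfl)
      have hm : ∀ γ ∈ m, γ ∈ D := fun γ hγ => hl γ (Or.inl hγ)
      have hneg : ¬ R.Pos ((m.map R.refl).prod α) := by
        intro h
        refine h.not_neg ?_
        have := hpos α (mem_levi_of_mem hD hα) (pos_of_mem_base (hD hα))
        rw [LinearEquiv.mul_apply, R.refl_self (R.base_subset α (hD hα)), map_neg] at this
        exact this
      obtain ⟨l', hl', hlen, hprod⟩ := exchange hD (hD hα) m hm hneg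
      rw [← hprod] at hpos ⊢
      exact ih l'.length (by omega) l' hl' hpos rfl

/-! ### Reflections in the roots of a Levi subsystem -/

/-- The canonical Weyl-invariant form. -/
noncomputable def form (R : BasedRootSystem V) (x y : V) : ℝ :=
  ∑ β ∈ R.finite_root.toFinset, R.coroot β x * R.coroot β y

lemma form_refl {α : V} (hα : α ∈ R.root) (x y : V) :
    R.form (R.refl α x) (R.refl α y) = R.form x y := by
  unfold form
  have hmem : ∀ β ∈ R.finite_root.toFinset, R.refl α β ∈ R.finite_root.toFinset := by
    intro β hβ
    rw [Set.Finite.mem_toFinset] at hβ ⊢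
    exact R.refl_mem α hα β hβ
  refine Finset.sum_bij' (fun β _ => R.refl α β) (fun β _ => R.refl α β) hmem hmem
    (fun β _ => R.refl_refl hα β) (fun β _ => R.refl_refl hα β) fun β hβ => ?_
  rw [Set.Finite.mem_toFinset] at hβ
  have h : ∀ z, R.coroot (R.refl α β) z = R.coroot β (R.refl α z) := fun z => by
    rw [← coroot_apply (refl_mem_reflGroup hα) hβ, R.refl_refl hα]
  rw [h, h]

lemma form_self_pos {α : V} (hα : α ∈ R.root) : 0 < R.form α α := by
  refine Finset.sum_pos' (fun β _ => mul_self_nonneg _)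
    ⟨α, (Set.Finite.mem_toFinset _).2 hα, ?_⟩
  rw [R.coroot_self α hα]
  norm_num

lemma two_mul_form {α : V} (hα : α ∈ R.root) (y : V) :
    2 * R.form α y = R.coroot α y * R.form α α := by
  have h := form_refl hα α y
  rw [R.refl_self hα, R.refl_apply α hα] at h
  have h2 : R.form (-α) (y - R.coroot α y • α) = -R.form α y + R.coroot α y * R.form α α := by
    unfold form
    rw [Finset.mul_sum, ← Finset.sum_neg_distrib, ← Finset.sum_add_distrib]
    refine Finset.sum_congr rfl fun β _ => ?_
    simp only [map_neg, map_sub, map_smul, smul_eq_mul]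
    ring
  linarith

lemma form_eq_sum (x y : V) : R.form x y = ∑ α ∈ R.base, R.coord α x * R.form α y := by
  unfold form
  simp_rw [Finset.mul_sum]
  rw [Finset.sum_comm]
  refine Finset.sum_congr rfl fun β _ => ?_
  conv_lhs => rw [← R.sum_coord x]
  rw [map_sum, Finset.sum_mul]
  refine Finset.sum_congr rfl fun α _ => ?_
  rw [map_smul, smul_eq_mul, mul_assoc]

lemma exists_coroot_pos {D : Finset V} {β : V} (hβ : β ∈ R.levi D)
    (hpos : R.Pos β) : ∃ α ∈ D, 0 < R.coroot α β := by
  by_contra! h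
  have h1 := form_self_pos hβ.1
  rw [form_eq_sum] at h1
  refine h1.not_ge (Finset.sum_nonpos fun α hα => ?_)
  by_cases hαD : α ∈ D
  · refine mul_nonpos_of_nonneg_of_nonpos (hpos.2 α hα) ?_
    have h2 := two_mul_form (R.base_subset α hα) β
    have h3 := mul_nonpos_of_nonpos_of_nonneg (h α hαD)
      (form_self_pos (R.base_subset α hα)).le
    linarith
  · rw [hβ.2 α hα hαD, zero_mul]

lemma refl_mem_reflGroup_of_pos {D : Finset V} (hD : D ⊆ R.base) {β : V} (hβ : β ∈ R.levi D)
    (hpos : R.Pos β) : R.refl β ∈ R.reflGroup D := by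
  by_contra hcon
  let S : Set V := {γ | γ ∈ R.levi D ∧ R.Pos γ ∧ R.refl γ ∉ R.reflGroup D}
  have hfin : S.Finite := R.finite_root.subset fun γ hγ => hγ.1.1
  obtain ⟨γ, ⟨hγ, hγpos, hγn⟩, hmin⟩ := Set.exists_min_image S
    (fun x => ∑ δ ∈ R.base, R.coord δ x) hfin ⟨β, hβ, hpos, hcon⟩
  obtain ⟨α, hα, hαγ⟩ := exists_coroot_pos hγ hγpos
  have hαr := R.base_subset α (hD hα)
  have hne : γ ≠ α := by
    rintro rfl
    exact hγn (refl_mem_reflGroup hα)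
  have hαW : R.refl α ∈ R.reflGroup D := refl_mem_reflGroup hα
  have hconj : R.refl (R.refl α γ) = R.refl α * R.refl γ * R.refl α := by
    rw [← refl_apply_mul (refl_mem_reflGroup hαr) hγ.1, mul_assoc, R.refl_mul_self hαr, mul_one]
  have hS : R.refl α γ ∈ S := by
    refine ⟨refl_mem_levi hD hα hγ, hγpos.refl (hD hα) hne, fun h => hγn ?_⟩
    rw [hconj, Subgroup.mul_mem_cancel_right _ hαW, Subgroup.mul_mem_cancel_left _ hαW] at h
    exact h
  have hle := hmin _ hS
  refine hle.not_gt ?_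
  refine Finset.sum_lt_sum (fun δ hδ => ?_) ⟨α, hD hα, ?_⟩
  · by_cases hδα : δ = α
    · subst hδα
      rw [R.refl_apply δ hαr, map_sub, map_smul, R.coord_self δ hδ, smul_eq_mul]
      linarith
    · rw [coord_refl_of_ne (hD hα) hδ hδα]
  · rw [R.refl_apply α hαr, map_sub, map_smul, R.coord_self α (hD hα), smul_eq_mul]
    linarith

lemma refl_neg {β : V} (hβ : β ∈ R.root) : R.refl (-β) = R.refl β := by
  have h := refl_apply_mul (refl_mem_reflGroup hβ) hβ
  rw [R.refl_self hβ] at h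
  exact mul_right_cancel h

lemma refl_mem_reflGroup_of_mem_levi {D : Finset V} (hD : D ⊆ R.base) {β : V}
    (hβ : β ∈ R.levi D) : R.refl β ∈ R.reflGroup D := by
  rcases pos_or_pos_neg hβ.1 with h | h
  · exact refl_mem_reflGroup_of_pos hD hβ h
  · rw [← refl_neg hβ.1]
    exact refl_mem_reflGroup_of_pos hD (neg_mem_levi hβ) h

/-! ### Adapted elements and free double cosets -/

lemma adapted_mul_iff {L M : Finset V} (hL : L ⊆ R.base) (w : V ≃ₗ[ℝ] V) {u : V ≃ₗ[ℝ] V}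
    (hu : u ∈ R.reflGroup L) : R.Adapted L M (w * u) ↔ R.Adapted L M w := by
  refine forall₂_congr fun β _ => ?_
  have : (w * u)⁻¹ β ∈ R.parabolic L ↔ w⁻¹ β ∈ R.parabolic L := by
    rw [mul_inv_rev, LinearEquiv.mul_apply]
    refine ⟨fun h => ?_, apply_mem_parabolic hL (inv_mem hu)⟩
    have := apply_mem_parabolic hL hu h
    rwa [apply_inv_apply] at this
  rw [this]

lemma Adapted.eq_one {L M : Finset V} (hM : M ⊆ R.base) {w a : V ≃ₗ[ℝ] V}
    (hw : R.Adapted L M w) (ha : a ∈ R.reflGroup M) (haw : R.Adapted L M (a * w)) : a = 1 := by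
  refine eq_one_of_preserves_pos hM ha fun β hβ hpos => ?_
  rw [← haw _ (apply_mem_levi hM ha hβ), mul_inv_rev, LinearEquiv.mul_apply, inv_apply_apply,
    hw β hβ]
  exact hpos

lemma Adapted.injective {L M : Finset V} (hL : L ⊆ R.base) (hM : M ⊆ R.base) {w : V ≃ₗ[ℝ] V}
    (hw : R.Adapted L M w) : Function.Injective
      (fun p : ↥(R.reflGroup M) × ↥(R.reflGroup L) =>
        (p.1 : V ≃ₗ[ℝ] V) * w * (p.2 : V ≃ₗ[ℝ] V)) := by
  rintro ⟨⟨a, ha⟩, ⟨b, hb⟩⟩ ⟨⟨a', ha'⟩, ⟨b', hb'⟩⟩ h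
  change a * w * b = a' * w * b' at h
  have h1 : a'⁻¹ * a * w = w * (b' * b⁻¹) := by
    have h2 : a * w = a' * w * b' * b⁻¹ := by rw [← h, mul_inv_cancel_right]
    rw [mul_assoc, h2]
    group
  have h3 : a'⁻¹ * a = 1 := by
    refine hw.eq_one hM (mul_mem (inv_mem ha') ha) ?_
    rw [h1, adapted_mul_iff hL _ (mul_mem hb' (inv_mem hb))]
    exact hw
  obtain rfl : a' = a := inv_mul_eq_one.1 h3
  obtain rfl : b = b' := mul_left_cancel h
  rfl

/-- If the double coset of `w` is free then `w` moves `Φ_L` off `Φ_M`. -/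
lemma inv_apply_notMem_levi_of_injective {L M : Finset V} (hL : L ⊆ R.base) (hM : M ⊆ R.base)
    {w : V ≃ₗ[ℝ] V} (hw : w ∈ R.reflGroup R.root)
    (hinj : Function.Injective (fun p : ↥(R.reflGroup M) × ↥(R.reflGroup L) =>
      (p.1 : V ≃ₗ[ℝ] V) * w * (p.2 : V ≃ₗ[ℝ] V))) {β : V} (hβ : β ∈ R.levi M) :
    w⁻¹ β ∉ R.levi L := by
  intro hβL
  have hconj := refl_apply_mul hw hβL.1
  rw [apply_inv_apply] at hconj
  have h := @hinj (⟨_, refl_mem_reflGroup_of_mem_levi hM hβ⟩, 1)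
    (1, ⟨_, refl_mem_reflGroup_of_mem_levi hL hβL⟩) (by simpa using hconj)
  exact R.refl_ne_one hβ.1 (congrArg (fun p => (p.1 : V ≃ₗ[ℝ] V)) h)

lemma adapted_of_forall_mem_parabolic {L M : Finset V} {w : V ≃ₗ[ℝ] V}
    (hw : w ∈ R.reflGroup R.root) (hdisj : ∀ β ∈ R.levi M, w⁻¹ β ∉ R.levi L)
    (h : ∀ α ∈ M, w⁻¹ α ∈ R.parabolic L) : R.Adapted L M w := by
  have hpos : ∀ β ∈ R.levi M, R.Pos β → w⁻¹ β ∈ R.parabolic L := by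
    intro β hβ hβpos
    refine ⟨apply_mem_root (inv_mem hw) hβ.1, fun γ hγ hγL => ?_⟩
    rw [← R.sum_coord β, map_sum, map_sum]
    refine Finset.sum_nonneg fun α hα => ?_
    rw [map_smul, map_smul, smul_eq_mul]
    by_cases hαM : α ∈ M
    · exact mul_nonneg (hβpos.2 α hα) ((h α hαM).2 γ hγ hγL)
    · rw [hβ.2 α hα hαM, zero_mul]
  refine fun β hβ => ⟨fun hβp => ?_, hpos β hβ⟩
  refine (pos_or_pos_neg hβ.1).resolve_right fun hneg => hdisj β hβ ?_
  refine mem_levi_of_parabolic hβp ?_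
  rw [← map_neg]
  exact hpos _ (neg_mem_levi hβ) hneg

lemma exists_adapted {L M : Finset V} (hM : M ⊆ R.base) {w : V ≃ₗ[ℝ] V}
    (hw : w ∈ R.reflGroup R.root) (hdisj : ∀ β ∈ R.levi M, w⁻¹ β ∉ R.levi L) :
    ∃ a ∈ R.reflGroup M, R.Adapted L M (a * w) := by
  let S : (V ≃ₗ[ℝ] V) → Set V := fun w => {β ∈ R.levi M | ¬ R.Pos β ∧ w⁻¹ β ∈ R.parabolic L}
  have hS : ∀ w, (S w).Finite := fun w => R.finite_root.subset fun β hβ => hβ.1.1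
  induction hn : (S w).ncard using Nat.strong_induction_on generalizing w with
  | _ n ih =>
    subst hn
    by_cases h : ∀ α ∈ M, w⁻¹ α ∈ R.parabolic L
    · exact ⟨1, one_mem _, by rw [one_mul]; exact adapted_of_forall_mem_parabolic hw hdisj h⟩
    push Not at h
    obtain ⟨α, hα, hαp⟩ := h
    have hαr := R.base_subset α (hM hα)
    have hinv : ∀ x, (R.refl α * w)⁻¹ x = w⁻¹ (R.refl α x) := fun x => by
      rw [mul_inv_rev, R.refl_inv hαr, LinearEquiv.mul_apply]
    have hlt : (S (R.refl α * w)).ncard < (S w).ncard := by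
      rw [← Set.ncard_image_of_injective _ (R.refl α).injective]
      refine Set.ncard_lt_ncard (Set.ssubset_iff_exists.2 ⟨?_, -α, ?_, ?_⟩) (hS w)
      · rintro _ ⟨β, ⟨hβ, hβn, hβp⟩, rfl⟩
        rw [hinv] at hβp
        refine ⟨refl_mem_levi hM hα hβ, fun hpos => hβn ?_, hβp⟩
        have := hpos.refl (hM hα) (by intro heq; rw [heq] at hβp; exact hαp hβp)
        rwa [R.refl_refl hαr] at this
      · refine ⟨neg_mem_levi (mem_levi_of_mem hM hα), (pos_of_mem_base (hM hα)).not_neg, ?_⟩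
        rw [map_neg]
        exact (mem_parabolic_or_neg L (apply_mem_root (inv_mem hw) hαr)).resolve_left hαp
      · rintro ⟨β, ⟨_, hβn, _⟩, heq⟩
        refine hβn ?_
        rw [← R.refl_refl hαr β, heq, map_neg, R.refl_self hαr, neg_neg]
        exact pos_of_mem_base (hM hα)
    obtain ⟨a, ha, haw⟩ := ih _ hlt (mul_mem (refl_mem_reflGroup hαr) hw)
      (fun β hβ => by rw [hinv]; exact hdisj _ (refl_mem_levi hM hα hβ)) rfl
    exact ⟨a * R.refl α, mul_mem ha (refl_mem_reflGroup hα), by rwa [mul_assoc]⟩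

lemma bijOn_doubleCosets {L M : Finset V} (hL : L ⊆ R.base) (hM : M ⊆ R.base) :
    Set.BijOn
      (fun C : Set (V ≃ₗ[ℝ] V) => {x : V ≃ₗ[ℝ] V | ∃ a ∈ R.reflGroup M, ∃ c ∈ C, x = a * c})
      {C : Set (V ≃ₗ[ℝ] V) | ∃ w ∈ R.reflGroup R.root,
        R.Adapted L M w ∧ C = {x : V ≃ₗ[ℝ] V | ∃ u ∈ R.reflGroup L, x = w * u}}
      {D : Set (V ≃ₗ[ℝ] V) | ∃ w ∈ R.reflGroup R.root,
        D = {x : V ≃ₗ[ℝ] V | ∃ a ∈ R.reflGroup M, ∃ b ∈ R.reflGroup L, x = a * w * b} ∧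
        Function.Injective (fun p : ↥(R.reflGroup M) × ↥(R.reflGroup L) =>
          (p.1 : V ≃ₗ[ℝ] V) * w * (p.2 : V ≃ₗ[ℝ] V))} := by
  refine ⟨?_, ?_, ?_⟩
  · rintro _ ⟨w, hw, hwA, rfl⟩
    refine ⟨w, hw, ?_, hwA.injective hL hM⟩
    ext x
    constructor
    · rintro ⟨a, ha, _, ⟨u, hu, rfl⟩, rfl⟩
      exact ⟨a, ha, u, hu, (mul_assoc _ _ _).symm⟩
    · rintro ⟨a, ha, u, hu, rfl⟩
      exact ⟨a, ha, _, ⟨u, hu, rfl⟩, mul_assoc _ _ _⟩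
  · rintro _ ⟨w, hw, hwA, rfl⟩ _ ⟨w', hw', hwA', rfl⟩ h
    have hmem : w' ∈ {x : V ≃ₗ[ℝ] V | ∃ a ∈ R.reflGroup M,
        ∃ c ∈ {x : V ≃ₗ[ℝ] V | ∃ u ∈ R.reflGroup L, x = w * u}, x = a * c} := by
      refine (Set.ext_iff.1 h w').2 ⟨1, one_mem _, w', ⟨1, one_mem _, ?_⟩, ?_⟩ <;> simp
    obtain ⟨a, ha, _, ⟨u, hu, rfl⟩, rfl⟩ := hmem
    obtain rfl := ((adapted_mul_iff hL w hu).2 hwA).eq_one hM ha hwA'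
    ext x
    constructor
    · rintro ⟨v, hv, rfl⟩
      exact ⟨u⁻¹ * v, mul_mem (inv_mem hu) hv, by group⟩
    · rintro ⟨v, hv, rfl⟩
      exact ⟨u * v, mul_mem hu hv, by group⟩
  · rintro _ ⟨w, hw, rfl, hinj⟩
    obtain ⟨a, ha, haA⟩ := exists_adapted hM hw
      fun β hβ => inv_apply_notMem_levi_of_injective hL hM hw hinj hβ
    refine ⟨_, ⟨a * w, mul_mem (reflGroup_mono (subset_root_of_subset_base hM) ha) hw, haA,
      rfl⟩, ?_⟩
    ext x
    constructor
    · rintro ⟨b, hb, _, ⟨u, hu, rfl⟩, rfl⟩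
      exact ⟨b * a, mul_mem hb ha, u, hu, by group⟩
    · rintro ⟨b, hb, u, hu, rfl⟩
      exact ⟨b * a⁻¹, mul_mem hb (inv_mem ha), _, ⟨u, hu, rfl⟩, by group⟩

lemma image_inter_levi_eq_iff {L M : Finset V} (w : V ≃ₗ[ℝ] V) :
    (⇑w '' R.parabolic L) ∩ R.levi M = R.levi M ∩ {β | R.Pos β} ↔ R.Adapted L M w := by
  have himg : ∀ β, β ∈ ⇑w '' R.parabolic L ↔ w⁻¹ β ∈ R.parabolic L := fun β =>
    ⟨by rintro ⟨γ, hγ, rfl⟩; rwa [inv_apply_apply], fun h => ⟨_, h, apply_inv_apply w β⟩⟩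
  rw [Set.ext_iff]
  refine forall_congr' fun β => ?_
  rw [Set.mem_inter_iff, Set.mem_inter_iff, himg, Set.mem_ofPred_eq]
  tauto

lemma parabolic_eq (L : Finset V) : R.parabolic L = {β | R.Pos β} ∪ R.levi L := by
  ext β
  constructor
  · intro h
    rcases pos_or_pos_neg h.1 with hp | hp
    · exact Or.inl hp
    · exact Or.inr (mem_levi_of_parabolic h ⟨hp.1, fun γ hγ _ => hp.2 γ hγ⟩)
  · rintro (h | h)
    · exact ⟨h.1, fun γ hγ _ => h.2 γ hγ⟩
    · exact ⟨h.1, fun γ hγ hγL => (h.2 γ hγ hγL).ge⟩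

end BasedRootSystem

/-- A linearly independent spanning finset has a family of coordinate functionals. -/
lemma exists_coord {V : Type*} [AddCommGroup V] [Module ℝ V] (Δ : Finset V)
    (hind : LinearIndependent ℝ (fun a : {x : V // x ∈ Δ} => (a : V)))
    (hspan : ⊤ ≤ Submodule.span ℝ (Δ : Set V)) :
    ∃ f : V → (V →ₗ[ℝ] ℝ), (∀ α ∈ Δ, f α α = 1) ∧
      (∀ α ∈ Δ, ∀ β ∈ Δ, α ≠ β → f α β = 0) ∧ ∀ x, ∑ α ∈ Δ, f α x • α = x := by
  classical
  let b : Module.Basis {x : V // x ∈ Δ} ℝ V := Module.Basis.mk hind (by simpa using hspan)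
  have hb : ∀ a, b a = (a : V) := fun a => by simp [b]
  refine ⟨fun α => if h : α ∈ Δ then b.coord ⟨α, h⟩ else 0, ?_, ?_, ?_⟩
  · intro α hα
    have := b.coord_apply ⟨α, hα⟩ (b ⟨α, hα⟩)
    rw [Module.Basis.repr_self, Finsupp.single_eq_same, hb] at this
    simpa only [dif_pos hα] using this
  · intro α hα β hβ hne
    have := b.coord_apply ⟨α, hα⟩ (b ⟨β, hβ⟩)
    rw [Module.Basis.repr_self, Finsupp.single_eq_of_ne (by simpa using hne), hb] at this
    simpa only [dif_pos hα] using this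
  · intro x
    have h := b.sum_repr x
    rw [← Finset.sum_coe_sort Δ]
    conv_rhs => rw [← h]
    refine Finset.sum_congr rfl fun a _ => ?_
    simp only [hb, dif_pos a.2, Subtype.coe_eta, Module.Basis.coord_apply]


/-- Let `Φ` be a finite reduced crystallographic root system in a real vector space `V`, with
Weyl group `W = ⟨s_α : α ∈ Φ⟩`, a base `Δ` (simple roots, with positive system
`Φ⁺ = Φplus`), subsets `ΔL, ΔM ⊆ Δ` with standard parabolic subgroups `WL, WM`, root
subsystems `ΦL, ΦM` (roots in the ℤ-span of `ΔL` resp. `ΔM`), `Φ𝔭 = Φ⁺ ∪ ΦL` and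
`ΦM⁺ = ΦM ∩ Φ⁺`.  Then:
(i) for `w ∈ W` the condition `w(Φ𝔭) ∩ ΦM = ΦM⁺` depends only on the coset `wWL`; and
(ii) `wWL ↦ WM w WL` is a bijection from `{wWL ∈ W/WL : w(Φ𝔭) ∩ ΦM = ΦM⁺}` onto the set of
free `(WM, WL)` double cosets in `W` (cosets and double cosets being encoded as subsets of
the group of linear automorphisms of `V`). -/
theorem stmt3 (V : Type) [AddCommGroup V] [Module ℝ V]
    (Φ : Set V) (hΦfin : Φ.Finite) (hΦ0 : (0 : V) ∉ Φ)
    (hΦspan : Submodule.span ℝ Φ = ⊤)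
    (coroot : V → (V →ₗ[ℝ] ℝ))
    (hcoroot2 : ∀ α ∈ Φ, coroot α α = 2)
    (sRefl : V → (V ≃ₗ[ℝ] V))
    (hsRefl : ∀ α ∈ Φ, ∀ x : V, sRefl α x = x - coroot α x • α)
    (hreflΦ : ∀ α ∈ Φ, ∀ β ∈ Φ, sRefl α β ∈ Φ)
    (hcrys : ∀ α ∈ Φ, ∀ β ∈ Φ, ∃ n : ℤ, coroot α β = (n : ℝ))
    (hred : ∀ α ∈ Φ, ∀ c : ℝ, c • α ∈ Φ → c = 1 ∨ c = -1)
    (Δ : Finset V) (hΔΦ : (Δ : Set V) ⊆ Φ)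
    (hΔind : LinearIndependent ℝ (fun a : {x : V // x ∈ Δ} => (a : V)))
    (hbase : ∀ β ∈ Φ,
      (∃ c : V → ℕ, β = ∑ α ∈ Δ, (c α : ℝ) • α) ∨
      (∃ c : V → ℕ, β = -∑ α ∈ Δ, (c α : ℝ) • α))
    (ΔL ΔM : Finset V) (hΔL : ΔL ⊆ Δ) (hΔM : ΔM ⊆ Δ)
    (Φplus : Set V)
    (hΦplus : Φplus = {β ∈ Φ | ∃ c : V → ℕ, β = ∑ α ∈ Δ, (c α : ℝ) • α})
    (ΦL ΦM : Set V)
    (hΦL : ΦL = {β ∈ Φ | β ∈ Submodule.span ℤ (ΔL : Set V)})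
    (hΦM : ΦM = {β ∈ Φ | β ∈ Submodule.span ℤ (ΔM : Set V)})
    (W WL WM : Subgroup (V ≃ₗ[ℝ] V))
    (hW : W = Subgroup.closure (sRefl '' Φ))
    (hWL : WL = Subgroup.closure (sRefl '' (ΔL : Set V)))
    (hWM : WM = Subgroup.closure (sRefl '' (ΔM : Set V)))
    (Φp : Set V) (hΦp : Φp = Φplus ∪ ΦL)
    (ΦMplus : Set V) (hΦMplus : ΦMplus = ΦM ∩ Φplus) :
    (∀ w ∈ W, ∀ u ∈ WL,
        ((⇑(w * u) '' Φp) ∩ ΦM = ΦMplus ↔ (⇑w '' Φp) ∩ ΦM = ΦMplus))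
    ∧ Set.BijOn
        (fun C : Set (V ≃ₗ[ℝ] V) => {x : V ≃ₗ[ℝ] V | ∃ a ∈ WM, ∃ c ∈ C, x = a * c})
        {C : Set (V ≃ₗ[ℝ] V) | ∃ w ∈ W,
          ((⇑w '' Φp) ∩ ΦM = ΦMplus) ∧ C = {x : V ≃ₗ[ℝ] V | ∃ u ∈ WL, x = w * u}}
        {D : Set (V ≃ₗ[ℝ] V) | ∃ w ∈ W,
          D = {x : V ≃ₗ[ℝ] V | ∃ a ∈ WM, ∃ b ∈ WL, x = a * w * b} ∧
          Function.Injective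
            (fun p : ↥WM × ↥WL => (p.1 : V ≃ₗ[ℝ] V) * w * (p.2 : V ≃ₗ[ℝ] V))} := by
  classical
  have hmem_span : ∀ c : V → ℕ, ∑ α ∈ Δ, (c α : ℝ) • α ∈ Submodule.span ℝ (Δ : Set V) :=
    fun c => Submodule.sum_mem _ fun α hα =>
      Submodule.smul_mem _ _ (Submodule.subset_span hα)
  have hspan : ⊤ ≤ Submodule.span ℝ (Δ : Set V) := by
    rw [← hΦspan, Submodule.span_le]
    intro β hβ
    rcases hbase β hβ with ⟨c, rfl⟩ | ⟨c, rfl⟩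
    · exact hmem_span c
    · exact Submodule.neg_mem _ (hmem_span c)
  obtain ⟨f, hf1, hf0, hfsum⟩ := exists_coord Δ hΔind hspan
  have hf : ∀ (c : V → ℕ), ∀ γ ∈ Δ, f γ (∑ α ∈ Δ, (c α : ℝ) • α) = c γ := by
    intro c γ hγ
    rw [map_sum, Finset.sum_eq_single_of_mem γ hγ]
    · rw [map_smul, hf1 γ hγ, smul_eq_mul, mul_one]
    · intro α hα hne
      rw [map_smul, hf0 γ hγ α hα hne.symm, smul_zero]
  let R : BasedRootSystem V :=
    { root := Φ, finite_root := hΦfin, span_root := hΦspan, coroot := coroot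
      coroot_self := hcoroot2, refl := sRefl, refl_apply := hsRefl, refl_mem := hreflΦ
      reduced := hred, base := Δ, base_subset := fun α hα => hΔΦ hα, coord := f
      coord_self := hf1, coord_of_ne := hf0, sum_coord := hfsum
      coord_sign := by
        intro β hβ
        rcases hbase β hβ with ⟨c, rfl⟩ | ⟨c, rfl⟩
        · exact Or.inl fun α hα => by rw [hf c α hα]; positivity
        · exact Or.inr fun α hα => by rw [map_neg, hf c α hα]; simp }
  have hplus : Φplus = {β | R.Pos β} := by
    rw [hΦplus]
    ext β
    constructor
    · rintro ⟨hβ, c, rfl⟩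
      exact ⟨hβ, fun α hα => (hf c α hα).symm ▸ Nat.cast_nonneg _⟩
    · intro h
      refine ⟨h.1, ?_⟩
      rcases hbase β h.1 with hc | ⟨c, hc⟩
      · exact hc
      · refine absurd (show R.Pos (-β) from ⟨R.neg_mem h.1, fun α hα => ?_⟩) h.not_neg
        change 0 ≤ f α (-β)
        rw [hc, neg_neg, hf c α hα]
        positivity
  have hlevi : ∀ D ⊆ Δ, {β ∈ Φ | β ∈ Submodule.span ℤ (D : Set V)} = R.levi D := by
    intro D hD
    have hsum : ∀ c : V → ℕ, (∀ α ∈ Δ, α ∉ D → (c α : ℝ) = 0) →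
        ∑ α ∈ Δ, (c α : ℝ) • α ∈ Submodule.span ℤ (D : Set V) := by
      intro c hc
      refine Submodule.sum_mem _ fun α hα => ?_
      by_cases hαD : α ∈ D
      · rw [Nat.cast_smul_eq_nsmul]
        exact Submodule.smul_of_tower_mem _ _ (Submodule.subset_span hαD)
      · rw [hc α hα hαD, zero_smul]
        exact Submodule.zero_mem _
    ext β
    constructor
    · rintro ⟨hβ, hβD⟩
      refine ⟨hβ, fun γ hγ hγD => ?_⟩
      change f γ β = 0
      clear hβ
      induction hβD using Submodule.span_induction with
      | mem x hx => exact hf0 γ hγ x (hD hx) (by rintro rfl; exact hγD hx)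
      | zero => exact map_zero _
      | add x y _ _ hx hy => rw [map_add, hx, hy, add_zero]
      | smul n x _ hx => rw [map_zsmul, hx, smul_zero]
    · rintro ⟨hβ, h⟩
      change ∀ α ∈ Δ, α ∉ D → f α β = 0 at h
      refine ⟨hβ, ?_⟩
      rcases hbase β hβ with ⟨c, rfl⟩ | ⟨c, rfl⟩
      · exact hsum c fun α hα hαD => by rw [← hf c α hα, h α hα hαD]
      · refine Submodule.neg_mem _ (hsum c fun α hα hαD => ?_)
        have := h α hα hαD
        rwa [map_neg, neg_eq_zero, hf c α hα] at this
  rw [hlevi ΔL hΔL] at hΦL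
  rw [hlevi ΔM hΔM] at hΦM
  have hpar : Φp = R.parabolic ΔL := by
    rw [hΦp, hplus, hΦL, BasedRootSystem.parabolic_eq]
  rw [hΦM, hplus] at hΦMplus
  replace hW : W = R.reflGroup R.root := hW
  replace hWL : WL = R.reflGroup ΔL := hWL
  replace hWM : WM = R.reflGroup ΔM := hWM
  subst hΦM hpar hΦMplus hW hWL hWM
  simp only [BasedRootSystem.image_inter_levi_eq_iff]
  exact ⟨fun w _ u hu => BasedRootSystem.adapted_mul_iff hΔL w hu,
    BasedRootSystem.bijOn_doubleCosets hΔL hΔM⟩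
end

section
/- Let Φ ⊂ 𝔥* be a finite reduced crystallographic root system with Weyl group W acting on the complex vector space 𝔥, fix a base Σ, and for subsets Σ_L, Σ_M ⊆ Σ let W_L, W_M ≤ W be the standard parabolic subgroups generated by the corresponding simple reflections; let 𝔷(𝔪) = {λ ∈ 𝔥 : α(λ) = 0 for all α ∈ Σ_M}. Suppose w₁, w₂ ∈ W are such that the double cosets W_M w₁ W_L and W_M w₂ W_L are free, and that for every W_L-invariant polynomial function s ∈ ℂ[𝔥]^{W_L} and every λ ∈ 𝔷(𝔪) one has s(w₁⁻¹λ) = s(w₂⁻¹λ). Then W_M w₁ W_L = W_M w₂ W_L. -/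
open Module

/-- A reduced crystallographic root system `Φ` in the dual of `H`, with coroots `cv`, reflections
`s`, simple roots `Δ` and fundamental coweights `ω`, every root having all its coefficients
of the same sign. -/
structure IsBasedRootSystem {H : Type*} [AddCommGroup H] [Module ℂ H] (Φ : Set (Dual ℂ H))
    (cv : Dual ℂ H → H) (Δ : Finset (Dual ℂ H)) (s : Dual ℂ H → (H ≃ₗ[ℂ] H))
    (ω : Dual ℂ H → H) : Prop where
  finite : Φ.Finite
  span_eq_top : Submodule.span ℂ Φ = ⊤
  root_coroot_two : ∀ α ∈ Φ, α (cv α) = 2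
  sub_mem : ∀ α ∈ Φ, ∀ β ∈ Φ, β - β (cv α) • α ∈ Φ
  exists_int : ∀ α ∈ Φ, ∀ β ∈ Φ, ∃ n : ℤ, β (cv α) = n
  reduced : ∀ α ∈ Φ, ∀ c : ℂ, c • α ∈ Φ → c = 1 ∨ c = -1
  subset : ∀ α ∈ Δ, α ∈ Φ
  apply_reflection : ∀ α ∈ Φ, ∀ l : H, s α l = l - α l • cv α
  coweight_self : ∀ α ∈ Δ, α (ω α) = 1
  coweight_ne : ∀ α ∈ Δ, ∀ β ∈ Δ, α ≠ β → α (ω β) = 0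
  sum_coweight : ∀ β : Dual ℂ H, β = ∑ α ∈ Δ, β (ω α) • α
  pos_or_neg : ∀ β ∈ Φ, (∀ α ∈ Δ, ∃ n : ℕ, β (ω α) = n) ∨ (∀ α ∈ Δ, ∃ n : ℕ, β (ω α) = -n)

namespace IsBasedRootSystem

variable {H : Type*} [AddCommGroup H] [Module ℂ H] {Φ : Set (Dual ℂ H)}
  {cv : Dual ℂ H → H} {Δ : Finset (Dual ℂ H)} {s : Dual ℂ H → (H ≃ₗ[ℂ] H)} {ω : Dual ℂ H → H}

theorem reflection_mul_self (h : IsBasedRootSystem Φ cv Δ s ω) {α : Dual ℂ H} (hα : α ∈ Φ) :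
    s α * s α = 1 := by
  ext l
  simp only [LinearEquiv.mul_apply, h.apply_reflection α hα, map_sub, map_smul, smul_eq_mul,
    h.root_coroot_two α hα, LinearEquiv.coe_one, id_eq]
  module

theorem reflection_inv (h : IsBasedRootSystem Φ cv Δ s ω) {α : Dual ℂ H} (hα : α ∈ Φ) :
    (s α)⁻¹ = s α :=
  inv_eq_of_mul_eq_one_left (h.reflection_mul_self hα)

theorem comp_reflection (h : IsBasedRootSystem Φ cv Δ s ω) {α : Dual ℂ H} (hα : α ∈ Φ)
    (β : Dual ℂ H) : β ∘ₗ (s α : H →ₗ[ℂ] H) = β - β (cv α) • α := by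
  ext l
  simp [h.apply_reflection α hα, mul_comm]

theorem comp_mem_of_mem_closure (h : IsBasedRootSystem Φ cv Δ s ω) {w : H ≃ₗ[ℂ] H}
    (hw : w ∈ Subgroup.closure (s '' Φ)) :
    ∀ β ∈ Φ, β ∘ₗ (w : H →ₗ[ℂ] H) ∈ Φ := by
  rw [← Subgroup.mem_toSubmonoid, Subgroup.closure_toSubmonoid] at hw
  induction hw using Submonoid.closure_induction with
  | mem x hx =>
    intro β hβ
    rcases hx with ⟨α, hα, rfl⟩ | hx
    · rw [h.comp_reflection hα]
      exact h.sub_mem α hα β hβ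
    · obtain ⟨α, hα, hx⟩ := hx
      rw [← inv_inv x, ← hx, h.reflection_inv hα, h.comp_reflection hα]
      exact h.sub_mem α hα β hβ
  | one => exact fun β hβ => hβ
  | mul x y _ _ hx hy => exact fun β hβ => hy _ (hx β hβ)

theorem finite_of_le (h : IsBasedRootSystem Φ cv Δ s ω) {G : Subgroup (H ≃ₗ[ℂ] H)}
    (hG : G ≤ Subgroup.closure (s '' Φ)) : Finite G := by
  have := h.finite.to_subtype
  let f : G → Φ → Φ := fun w β => ⟨_, h.comp_mem_of_mem_closure (hG w.2) β β.2⟩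
  refine Finite.of_injective f fun w w' hww => ?_
  have key : ∀ β : Dual ℂ H, ∀ l, β ((w : H ≃ₗ[ℂ] H) l) = β ((w' : H ≃ₗ[ℂ] H) l) := by
    intro β
    have hβ : β ∈ Submodule.span ℂ Φ := h.span_eq_top ▸ Submodule.mem_top
    induction hβ using Submodule.span_induction with
    | mem β hβ => exact fun l => LinearMap.congr_fun (congrArg Subtype.val (congrFun hww ⟨β, hβ⟩)) l
    | zero => simp
    | add x y _ _ hx hy => simp [hx, hy]
    | smul c x _ hx => simp [hx]
  ext l
  rw [← sub_eq_zero, ← forall_dual_apply_eq_zero_iff ℂ]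
  intro β
  rw [map_sub, key, sub_self]

theorem coroot_comp_inv (h : IsBasedRootSystem Φ cv Δ s ω) {w : H ≃ₗ[ℂ] H}
    (hw : w ∈ Subgroup.closure (s '' Φ)) {α : Dual ℂ H} (hα : α ∈ Φ) :
    cv (α ∘ₗ ((w⁻¹ : H ≃ₗ[ℂ] H) : H →ₗ[ℂ] H)) = w (cv α) := by
  set γ : Dual ℂ H := α ∘ₗ ((w⁻¹ : H ≃ₗ[ℂ] H) : H →ₗ[ℂ] H) with hγ
  have hγΦ : γ ∈ Φ := h.comp_mem_of_mem_closure (inv_mem hw) α hα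
  have hww : ∀ l, (w⁻¹ : H ≃ₗ[ℂ] H) (w l) = l := fun l => w.symm_apply_apply l
  have := Dual.eq_of_preReflection_mapsTo (x := γ) h.finite h.span_eq_top
    (f := Dual.eval ℂ H (cv γ)) (g := Dual.eval ℂ H (w (cv α)))
    (by simpa using h.root_coroot_two γ hγΦ)
    (fun β hβ => by simpa [preReflection_apply] using h.sub_mem γ hγΦ β hβ)
    (by simpa [hγ, hww] using h.root_coroot_two α hα)
    (fun β hβ => by
      have h1 := h.comp_mem_of_mem_closure (inv_mem hw) _
        (h.sub_mem α hα _ (h.comp_mem_of_mem_closure hw β hβ))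
      convert h1 using 1
      ext l
      simp [preReflection_apply, hγ])
  rw [← sub_eq_zero, ← forall_dual_apply_eq_zero_iff ℂ]
  intro β
  have := LinearMap.congr_fun this β
  simpa [sub_eq_zero] using this

theorem reflection_comp_inv (h : IsBasedRootSystem Φ cv Δ s ω) {w : H ≃ₗ[ℂ] H}
    (hw : w ∈ Subgroup.closure (s '' Φ)) {α : Dual ℂ H} (hα : α ∈ Φ) :
    s (α ∘ₗ ((w⁻¹ : H ≃ₗ[ℂ] H) : H →ₗ[ℂ] H)) = w * s α * w⁻¹ := by
  ext l
  rw [h.apply_reflection _ (h.comp_mem_of_mem_closure (inv_mem hw) α hα), h.coroot_comp_inv hw hα]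
  simp [LinearEquiv.mul_apply, h.apply_reflection α hα]

theorem exists_sum_sq (h : IsBasedRootSystem Φ cv Δ s ω) {β : Dual ℂ H} (hβ : β ∈ Φ) :
    ∃ m : ℤ, 0 < m ∧ ∑ γ ∈ h.finite.toFinset, γ (cv β) * γ (cv β) = m := by
  have hn : ∀ γ : Dual ℂ H, ∃ n : ℤ, γ ∈ Φ → γ (cv β) = n := fun γ => by
    by_cases hγ : γ ∈ Φ
    · obtain ⟨n, hn⟩ := h.exists_int β hβ γ hγ
      exact ⟨n, fun _ => hn⟩
    · exact ⟨0, fun h => (hγ h).elim⟩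
  choose n hn using hn
  refine ⟨∑ γ ∈ h.finite.toFinset, n γ * n γ, ?_, ?_⟩
  · refine Finset.sum_pos' (fun γ _ => mul_self_nonneg _) ⟨β, by simpa using hβ, ?_⟩
    have h2 : n β = 2 := by
      have := hn β hβ
      rw [h.root_coroot_two β hβ] at this
      exact_mod_cast this.symm
    rw [h2]; norm_num
  · push_cast
    refine Finset.sum_congr rfl fun γ hγ => ?_
    rw [hn γ (by simpa using hγ)]

theorem apply_mul_sum_sq (h : IsBasedRootSystem Φ cv Δ s ω) {β : Dual ℂ H} (hβ : β ∈ Φ) (x : H) :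
    β x * ∑ γ ∈ h.finite.toFinset, γ (cv β) * γ (cv β)
      = 2 * ∑ γ ∈ h.finite.toFinset, γ x * γ (cv β) := by
  have key : ∑ γ ∈ h.finite.toFinset, γ x * γ (cv β)
      = ∑ γ ∈ h.finite.toFinset, (γ - γ (cv β) • β) x * (γ - γ (cv β) • β) (cv β) := by
    symm
    refine Finset.sum_bij' (fun γ _ => γ - γ (cv β) • β) (fun γ _ => γ - γ (cv β) • β)
      ?_ ?_ ?_ ?_ ?_
    · intro γ hγ
      simpa using h.sub_mem β hβ γ (by simpa using hγ)
    · intro γ hγ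
      simpa using h.sub_mem β hβ γ (by simpa using hγ)
    · intro γ hγ
      simp only [LinearMap.sub_apply, LinearMap.smul_apply, smul_eq_mul, h.root_coroot_two β hβ]
      module
    · intro γ hγ
      simp only [LinearMap.sub_apply, LinearMap.smul_apply, smul_eq_mul, h.root_coroot_two β hβ]
      module
    · intro γ hγ
      rfl
  have key2 : ∑ γ ∈ h.finite.toFinset, (γ - γ (cv β) • β) x * (γ - γ (cv β) • β) (cv β)
      = β x * ∑ γ ∈ h.finite.toFinset, γ (cv β) * γ (cv β)
        - ∑ γ ∈ h.finite.toFinset, γ x * γ (cv β) := by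
    rw [Finset.mul_sum, ← Finset.sum_sub_distrib]
    refine Finset.sum_congr rfl fun γ _ => ?_
    simp only [LinearMap.sub_apply, LinearMap.smul_apply, smul_eq_mul, h.root_coroot_two β hβ]
    ring
  rw [key2] at key
  linear_combination -key

theorem pairing_pos_symm (h : IsBasedRootSystem Φ cv Δ s ω) {α β : Dual ℂ H} (hα : α ∈ Φ)
    (hβ : β ∈ Φ) {m n : ℤ} (hm : α (cv β) = m) (hn : β (cv α) = n) (hpos : 0 < m) : 0 < n := by
  obtain ⟨p, hp, hp'⟩ := h.exists_sum_sq hα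
  obtain ⟨q, hq, hq'⟩ := h.exists_sum_sq hβ
  have h1 := h.apply_mul_sum_sq hα (cv β)
  have h2 := h.apply_mul_sum_sq hβ (cv α)
  simp only [mul_comm (_ : ℂ) ((_ : Dual ℂ H) (cv β))] at h1 h2
  have h3 : m * p = n * q := by
    have : (m : ℂ) * p = n * q := by
      rw [← hm, ← hn, ← hp', ← hq']
      linear_combination h1 - h2
    exact_mod_cast this
  have h4 : 0 < n * q := h3 ▸ mul_pos hpos hp
  exact pos_of_mul_pos_left h4 hq.le

/-- A simple reflection only changes the sign of its own simple root. -/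
theorem eq_simple_of_pos_of_neg (h : IsBasedRootSystem Φ cv Δ s ω) {α β : Dual ℂ H} (hα : α ∈ Δ)
    (hβ : β ∈ Φ) (hpos : ∀ γ ∈ Δ, ∃ n : ℕ, β (ω γ) = n) (c : ℂ)
    (hneg : ∀ γ ∈ Δ, ∃ n : ℕ, (β - c • α) (ω γ) = -n) : β = α := by
  have h0 : ∀ γ ∈ Δ, γ ≠ α → β (ω γ) • γ = 0 := by
    intro γ hγ hne
    obtain ⟨n, hn⟩ := hpos γ hγ
    obtain ⟨m, hm⟩ := hneg γ hγ
    simp only [LinearMap.sub_apply, LinearMap.smul_apply, h.coweight_ne α hα γ hγ hne.symm, hn,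
      smul_zero, sub_zero] at hm
    have hnm : (n : ℤ) = -m := by exact_mod_cast hm
    have : n = 0 := by omega
    rw [hn, this]; simp
  have h1 : β = β (ω α) • α := by
    conv_lhs => rw [h.sum_coweight β]
    exact Finset.sum_eq_single_of_mem α hα h0
  obtain ⟨n, hn⟩ := hpos α hα
  rcases h.reduced α (h.subset α hα) (β (ω α)) (h1 ▸ hβ) with h2 | h2
  · rw [h1, h2, one_smul]
  · rw [hn] at h2
    have : (n : ℤ) = -1 := by exact_mod_cast h2
    omega

theorem reflection_mem_closure_simple_of_pos (h : IsBasedRootSystem Φ cv Δ s ω) (N : ℕ) :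
    ∀ β ∈ Φ, (∀ γ ∈ Δ, ∃ n : ℕ, β (ω γ) = n) → ∑ γ ∈ Δ, β (ω γ) = N →
      s β ∈ Subgroup.closure (s '' (Δ : Set (Dual ℂ H))) := by
  induction N using Nat.strong_induction_on with
  | _ N ih =>
  intro β hβ hpos hN
  have hex : ∃ α ∈ Δ, ∃ m : ℤ, 0 < m ∧ α (cv β) = m := by
    by_contra! hcon
    have hb := LinearMap.congr_fun (h.sum_coweight β) (cv β)
    rw [h.root_coroot_two β hβ] at hb
    have hle : ∀ γ ∈ Δ, ∃ m : ℕ, (β (ω γ) • γ) (cv β) = -m := by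
      intro γ hγ
      obtain ⟨n, hn⟩ := hpos γ hγ
      obtain ⟨m, hm⟩ := h.exists_int β hβ γ (h.subset γ hγ)
      have hm0 : m ≤ 0 := by
        by_contra! h0
        exact hcon γ hγ m h0 hm
      obtain ⟨k, hk⟩ := Int.eq_ofNat_of_zero_le (neg_nonneg.2 hm0)
      obtain rfl : m = -k := by omega
      exact ⟨n * k, by simp [hn, hm]⟩
    choose! m hm using hle
    rw [LinearMap.sum_apply, Finset.sum_congr rfl hm, Finset.sum_neg_distrib] at hb
    have : (2 : ℤ) = -∑ γ ∈ Δ, (m γ : ℤ) := by exact_mod_cast hb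
    have h0 : (0 : ℤ) ≤ ∑ γ ∈ Δ, (m γ : ℤ) := Finset.sum_nonneg fun _ _ => by positivity
    omega
  obtain ⟨α, hα, m, hm, hmα⟩ := hex
  have hαΦ := h.subset α hα
  have hsα : s α ∈ Subgroup.closure (s '' (Δ : Set (Dual ℂ H))) :=
    Subgroup.subset_closure ⟨α, hα, rfl⟩
  obtain ⟨n, hn⟩ := h.exists_int α hαΦ β hβ
  have hnpos := h.pairing_pos_symm hαΦ hβ hmα hn hm
  have hβ' := h.sub_mem α hαΦ β hβ
  rcases h.pos_or_neg _ hβ' with hp | hneg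
  · have hsum : ∑ γ ∈ Δ, (β - β (cv α) • α) (ω γ) = N - n := by
      simp only [LinearMap.sub_apply, LinearMap.smul_apply, Finset.sum_sub_distrib, hN]
      rw [Finset.sum_eq_single_of_mem α hα
        (fun γ hγ hne => by rw [h.coweight_ne α hα γ hγ hne.symm, smul_zero]),
        h.coweight_self α hα, hn]
      simp
    have hp' := hp
    choose! k hk using hp'
    have hkN : ((∑ γ ∈ Δ, k γ : ℕ) : ℂ) = N - n := by
      rw [← hsum, Finset.sum_congr rfl hk]; push_cast; rfl
    have hkN' : ((∑ γ ∈ Δ, k γ : ℕ) : ℤ) = N - n := by exact_mod_cast hkN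
    have hmem := ih (∑ γ ∈ Δ, k γ) (by omega) _ hβ' hp (by rw [hsum, hkN])
    have hconj := h.reflection_comp_inv (w := s α) (Subgroup.subset_closure ⟨α, hαΦ, rfl⟩) hβ
    rw [h.reflection_inv hαΦ, h.comp_reflection hαΦ] at hconj
    have : s β = s α * s (β - β (cv α) • α) * s α := by
      rw [hconj]
      simp only [← mul_assoc, h.reflection_mul_self hαΦ, one_mul]
      simp [mul_assoc, h.reflection_mul_self hαΦ]
    rw [this]
    exact mul_mem (mul_mem hsα hmem) hsα
  · rwa [h.eq_simple_of_pos_of_neg hα hβ hpos _ hneg]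

theorem reflection_mem_closure_simple (h : IsBasedRootSystem Φ cv Δ s ω) {β : Dual ℂ H}
    (hβ : β ∈ Φ) : s β ∈ Subgroup.closure (s '' (Δ : Set (Dual ℂ H))) := by
  have hpos : ∀ β ∈ Φ, (∀ γ ∈ Δ, ∃ n : ℕ, β (ω γ) = n) →
      s β ∈ Subgroup.closure (s '' (Δ : Set (Dual ℂ H))) := by
    intro β hβ hp
    have hp' := hp
    choose! k hk using hp'
    refine h.reflection_mem_closure_simple_of_pos (∑ γ ∈ Δ, k γ) β hβ hp ?_
    rw [Finset.sum_congr rfl hk]; push_cast; rfl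
  rcases h.pos_or_neg β hβ with hp | hneg
  · exact hpos β hβ hp
  · have hs : s β ∈ Subgroup.closure (s '' Φ) := Subgroup.subset_closure ⟨β, hβ, rfl⟩
    have hβ' : β ∘ₗ (((s β)⁻¹ : H ≃ₗ[ℂ] H) : H →ₗ[ℂ] H) = -β := by
      rw [h.reflection_inv hβ, h.comp_reflection hβ, h.root_coroot_two β hβ]
      module
    have h1 := h.reflection_comp_inv hs hβ
    rw [hβ', mul_inv_cancel_right] at h1
    rw [← h1]
    refine hpos _ (hβ' ▸ h.comp_mem_of_mem_closure (inv_mem hs) β hβ) fun γ hγ => ?_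
    obtain ⟨n, hn⟩ := hneg γ hγ
    exact ⟨n, by simp [hn]⟩

theorem exists_word (h : IsBasedRootSystem Φ cv Δ s ω) {w : H ≃ₗ[ℂ] H}
    (hw : w ∈ Subgroup.closure (s '' Φ)) :
    ∃ L : List (Dual ℂ H), (∀ α ∈ L, α ∈ Δ) ∧ w = (L.map s).prod := by
  have hle : Subgroup.closure (s '' Φ) ≤ Subgroup.closure (s '' (Δ : Set (Dual ℂ H))) := by
    rw [Subgroup.closure_le]
    rintro _ ⟨β, hβ, rfl⟩
    exact h.reflection_mem_closure_simple hβ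
  replace hw := hle hw
  rw [← Subgroup.mem_toSubmonoid, Subgroup.closure_toSubmonoid] at hw
  induction hw using Submonoid.closure_induction with
  | mem x hx =>
    rcases hx with ⟨α, hα, rfl⟩ | ⟨α, hα, hx⟩
    · exact ⟨[α], by simpa using hα, by simp⟩
    · refine ⟨[α], by simpa using hα, ?_⟩
      rw [← inv_inv x, ← hx, h.reflection_inv (h.subset α hα)]
      simp
  | one => exact ⟨[], by simp, rfl⟩
  | mul x y _ _ hx hy =>
    obtain ⟨L, hL, rfl⟩ := hx
    obtain ⟨L', hL', rfl⟩ := hy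
    refine ⟨L ++ L', fun α hα => ?_, by simp⟩
    rcases List.mem_append.1 hα with hα | hα
    exacts [hL α hα, hL' α hα]

theorem prod_mem_closure (h : IsBasedRootSystem Φ cv Δ s ω) {L : List (Dual ℂ H)}
    (hL : ∀ α ∈ L, α ∈ Δ) : (L.map s).prod ∈ Subgroup.closure (s '' Φ) := by
  refine list_prod_mem fun x hx => ?_
  obtain ⟨α, hα, rfl⟩ := List.mem_map.1 hx
  exact Subgroup.subset_closure ⟨α, h.subset α (hL α hα), rfl⟩

/-- The exchange condition. -/
theorem exchange (h : IsBasedRootSystem Φ cv Δ s ω) {α : Dual ℂ H} (hα : α ∈ Δ)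
    (L : List (Dual ℂ H)) : (∀ β ∈ L, β ∈ Δ) →
    (∀ γ ∈ Δ, ∃ n : ℕ, α (((L.map s).prod⁻¹ : H ≃ₗ[ℂ] H) (ω γ)) = -n) →
    ∃ L' : List (Dual ℂ H), (∀ β ∈ L', β ∈ Δ) ∧ L'.length < L.length ∧
      (L.map s).prod * s α = (L'.map s).prod := by
  induction L with
  | nil =>
    intro _ hneg
    obtain ⟨n, hn⟩ := hneg α hα
    simp only [List.map_nil, List.prod_nil, inv_one, LinearEquiv.coe_one, id_eq,
      h.coweight_self α hα] at hn
    have : (1 : ℤ) = -n := by exact_mod_cast hn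
    omega
  | cons β L ih =>
    intro hL hneg
    have hβ := hL β (by simp)
    have hL' : ∀ γ ∈ L, γ ∈ Δ := fun γ hγ => hL γ (by simp [hγ])
    have hαΦ := h.subset α hα
    have hβΦ := h.subset β hβ
    have hw := h.prod_mem_closure hL'
    set w := (L.map s).prod with hwdef
    have hroot := h.comp_mem_of_mem_closure (inv_mem hw) α hαΦ
    rcases h.pos_or_neg _ hroot with hp | hn
    · have hab : α ∘ₗ ((w⁻¹ : H ≃ₗ[ℂ] H) : H →ₗ[ℂ] H) = β := by
        refine h.eq_simple_of_pos_of_neg hβ hroot hp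
          ((α ∘ₗ ((w⁻¹ : H ≃ₗ[ℂ] H) : H →ₗ[ℂ] H)) (cv β)) ?_
        intro γ hγ
        obtain ⟨n, hn⟩ := hneg γ hγ
        refine ⟨n, ?_⟩
        rw [← h.comp_reflection hβΦ, ← hn]
        simp only [List.map_cons, List.prod_cons, mul_inv_rev, h.reflection_inv hβΦ]
        rfl
      refine ⟨L, hL', by simp, ?_⟩
      have hconj := h.reflection_comp_inv hw hαΦ
      rw [hab] at hconj
      rw [List.map_cons, List.prod_cons, hconj, ← hwdef]
      simp [mul_assoc, h.reflection_mul_self hαΦ]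
    · obtain ⟨L', h1, h2, h3⟩ := ih hL' hn
      refine ⟨β :: L', ?_, by simpa using h2, ?_⟩
      · intro γ hγ
        rcases List.mem_cons.1 hγ with rfl | hγ
        exacts [hβ, h1 γ hγ]
      · rw [List.map_cons, List.prod_cons, List.map_cons, List.prod_cons, mul_assoc, h3]

/-- The stabilizer of a dominant coweight is generated by the simple reflections fixing it. -/
theorem mem_closure_of_apply_eq (h : IsBasedRootSystem Φ cv Δ s ω) {T : Set (Dual ℂ H)}
    {l : H} (hl : ∃ k : Dual ℂ H → ℕ, l = ∑ γ ∈ Δ, (k γ : ℂ) • ω γ)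
    (hT : ∀ α ∈ Δ, α l = 0 → α ∈ T) (N : ℕ) :
    ∀ L : List (Dual ℂ H), L.length = N → (∀ α ∈ L, α ∈ Δ) →
      (L.map s).prod l = l → (L.map s).prod ∈ Subgroup.closure (s '' T) := by
  obtain ⟨k, hk⟩ := hl
  induction N using Nat.strong_induction_on with
  | _ N ih =>
  intro L hN hL hfix
  rcases List.eq_nil_or_concat' L with rfl | ⟨L, α, rfl⟩
  · simp
  have hα : α ∈ Δ := hL α (by simp)
  have hαΦ := h.subset α hα
  have hL' : ∀ γ ∈ L, γ ∈ Δ := fun γ hγ => hL γ (by simp [hγ])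
  rw [List.length_append, List.length_singleton] at hN
  have hprod : ((L ++ [α]).map s).prod = (L.map s).prod * s α := by simp
  rw [hprod] at hfix ⊢
  have hw := h.prod_mem_closure hL'
  set w := (L.map s).prod with hwdef
  have hww : (w⁻¹ : H ≃ₗ[ℂ] H) l = s α l := by
    conv_lhs => rw [← hfix]
    exact w.symm_apply_apply _
  have hsl : α (s α l) = -α l := by
    rw [h.apply_reflection α hαΦ, map_sub, map_smul, h.root_coroot_two α hαΦ, smul_eq_mul]
    ring
  have hdom : ∃ a : ℕ, α l = a := by
    refine ⟨k α, ?_⟩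
    rw [hk, map_sum, Finset.sum_eq_single_of_mem α hα]
    · simp [h.coweight_self α hα]
    · intro γ hγ hne
      simp [h.coweight_ne α hα γ hγ hne.symm]
  rcases h.pos_or_neg _ (h.comp_mem_of_mem_closure (inv_mem hw) α hαΦ) with hp | hn
  · have hwl : ∃ b : ℕ, α ((w⁻¹ : H ≃ₗ[ℂ] H) l) = b := by
      choose! b hb using hp
      refine ⟨∑ γ ∈ Δ, k γ * b γ, ?_⟩
      conv_lhs => rw [hk]
      rw [map_sum, map_sum]
      push_cast
      refine Finset.sum_congr rfl fun γ hγ => ?_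
      rw [map_smul, map_smul, smul_eq_mul, ← hb γ hγ]
      rfl
    obtain ⟨a, ha⟩ := hdom
    obtain ⟨b, hb⟩ := hwl
    rw [hww, hsl, ha] at hb
    have hab : -(a : ℤ) = b := by exact_mod_cast hb
    have ha0 : α l = 0 := by
      rw [ha]
      have : a = 0 := by omega
      simp [this]
    have hsl' : s α l = l := by simp [h.apply_reflection α hαΦ, ha0]
    refine mul_mem (ih L.length (by omega) L rfl hL' ?_)
      (Subgroup.subset_closure ⟨α, hT α hα ha0, rfl⟩)
    rw [LinearEquiv.mul_apply, hsl'] at hfix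
    exact hfix
  · obtain ⟨L', h1, h2, h3⟩ := h.exchange hα L hL' hn
    rw [← hwdef] at h3
    rw [h3] at hfix ⊢
    exact ih L'.length (by omega) L' rfl h1 hfix

end IsBasedRootSystem

/-- Invariant polynomial functions separate the orbits of a finite linear group. -/
theorem exists_apply_eq_of_forall_invariant {H : Type*} [AddCommGroup H] [Module ℂ H]
    (G : Subgroup (H ≃ₗ[ℂ] H)) [Finite G] (x y : H)
    (hxy : ∀ s ∈ Algebra.adjoin ℂ {f : H → ℂ | ∃ ℓ : Dual ℂ H, f = ⇑ℓ},
      (∀ u ∈ G, ∀ l : H, s (u l) = s l) → s x = s y) :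
    ∃ u ∈ G, x = u y := by
  by_contra! hcon
  have := Fintype.ofFinite G
  obtain ⟨ℓ, hℓ⟩ := exists_dual_forall_apply_ne_zero (K := ℂ)
    (fun u : G => x - (u : H ≃ₗ[ℂ] H) y) (fun u => sub_ne_zero.2 (hcon u u.2))
  have h := hxy (∏ u : G, (algebraMap ℂ (H → ℂ) (ℓ x) - ⇑(ℓ ∘ₗ ((u : H ≃ₗ[ℂ] H) : H →ₗ[ℂ] H))))
    (prod_mem fun u _ => sub_mem (Subalgebra.algebraMap_mem _ _)
      (Algebra.subset_adjoin ⟨_, rfl⟩))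
    (fun u hu l => by
      simp only [Finset.prod_apply]
      refine Fintype.prod_equiv (Equiv.mulRight ⟨u, hu⟩) _ _ fun v => ?_
      simp)
  simp only [Finset.prod_apply] at h
  rw [Finset.prod_eq_zero (Finset.mem_univ 1) (by simp)] at h
  obtain ⟨u, -, hu⟩ := Finset.prod_eq_zero_iff.1 h.symm
  exact hℓ u (by simpa using hu)

/-- A linearly independent spanning finset of the dual has a dual basis in the space itself. -/
theorem exists_dual_family {H : Type*} [AddCommGroup H] [Module ℂ H] (Δ : Finset (Dual ℂ H))
    (hind : LinearIndependent ℂ (fun a : {x : Dual ℂ H // x ∈ Δ} => (a : Dual ℂ H)))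
    (hspan : ⊤ ≤ Submodule.span ℂ (Δ : Set (Dual ℂ H))) :
    ∃ ω : Dual ℂ H → H, (∀ α ∈ Δ, α (ω α) = 1) ∧
      (∀ α ∈ Δ, ∀ β ∈ Δ, α ≠ β → α (ω β) = 0) := by
  classical
  have : Module.Finite ℂ (Dual ℂ H) := ⟨Δ, top_le_iff.1 hspan⟩
  have : Module.Finite ℂ H := (finite_dual_iff ℂ).1 this
  let b := Basis.mk hind (by simpa using hspan)
  refine ⟨fun a => if ha : a ∈ Δ then (evalEquiv ℂ H).symm (b.dualBasis ⟨a, ha⟩) else 0, ?_, ?_⟩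
  · intro α hα
    have := b.dualBasis_apply_self ⟨α, hα⟩ ⟨α, hα⟩
    simpa [hα, b] using this
  · intro α hα β hβ hne
    have := b.dualBasis_apply_self ⟨β, hβ⟩ ⟨α, hα⟩
    simpa [hα, hβ, b, hne] using this

/-- Let `Φ ⊂ 𝔥*` be a finite reduced crystallographic root system (roots regarded as linear
functionals on the complex vector space `H = 𝔥`, with coroots `cv α ∈ H`), with Weyl group
`W ≤ GL(H)` generated by the reflections `sRefl α : λ ↦ λ − α(λ)·α∨`, a base `Δ`, subsets
`ΔL, ΔM ⊆ Δ` with standard parabolic subgroups `WL, WM ≤ W`, and let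
`𝔷(𝔪) = {λ ∈ H : α(λ) = 0 ∀ α ∈ ΔM}`.  Suppose `w₁, w₂ ∈ W` are such that the double cosets
`WM w₁ WL` and `WM w₂ WL` are free, and that `s(w₁⁻¹λ) = s(w₂⁻¹λ)` for every `WL`-invariant
polynomial function `s ∈ ℂ[H]^{WL}` (the subalgebra of `H → ℂ` generated by the linear
functionals) and every `λ ∈ 𝔷(𝔪)`.  Then `WM w₁ WL = WM w₂ WL`. -/
theorem stmt4 (H : Type) [AddCommGroup H] [Module ℂ H]
    (Φ : Set (Module.Dual ℂ H)) (hΦfin : Φ.Finite)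
    (hΦ0 : (0 : Module.Dual ℂ H) ∉ Φ)
    (hΦspan : Submodule.span ℂ Φ = ⊤)
    (cv : Module.Dual ℂ H → H)
    (hcv2 : ∀ α ∈ Φ, α (cv α) = 2)
    (hreflΦ : ∀ α ∈ Φ, ∀ β ∈ Φ, (β - β (cv α) • α) ∈ Φ)
    (hcrys : ∀ α ∈ Φ, ∀ β ∈ Φ, ∃ n : ℤ, β (cv α) = (n : ℂ))
    (hred : ∀ α ∈ Φ, ∀ c : ℂ, c • α ∈ Φ → c = 1 ∨ c = -1)
    (Δ : Finset (Module.Dual ℂ H)) (hΔΦ : (Δ : Set (Module.Dual ℂ H)) ⊆ Φ)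
    (hΔind : LinearIndependent ℂ
      (fun a : {x : Module.Dual ℂ H // x ∈ Δ} => (a : Module.Dual ℂ H)))
    (hbase : ∀ β ∈ Φ,
      (∃ c : Module.Dual ℂ H → ℕ, β = ∑ α ∈ Δ, (c α : ℂ) • α) ∨
      (∃ c : Module.Dual ℂ H → ℕ, β = -∑ α ∈ Δ, (c α : ℂ) • α))
    (ΔL ΔM : Finset (Module.Dual ℂ H)) (hΔL : ΔL ⊆ Δ) (hΔM : ΔM ⊆ Δ)
    (sRefl : Module.Dual ℂ H → (H ≃ₗ[ℂ] H))
    (hsRefl : ∀ α ∈ Φ, ∀ l : H, sRefl α l = l - α l • cv α)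
    (W WL WM : Subgroup (H ≃ₗ[ℂ] H))
    (hW : W = Subgroup.closure (sRefl '' Φ))
    (hWL : WL = Subgroup.closure (sRefl '' (ΔL : Set (Module.Dual ℂ H))))
    (hWM : WM = Subgroup.closure (sRefl '' (ΔM : Set (Module.Dual ℂ H))))
    (zm : Set H) (hzm : zm = {l : H | ∀ α ∈ ΔM, α l = 0})
    (w₁ w₂ : H ≃ₗ[ℂ] H) (hw₁ : w₁ ∈ W) (hw₂ : w₂ ∈ W)
    (hfree₁ : Function.Injective
      (fun p : ↥WM × ↥WL => (p.1 : H ≃ₗ[ℂ] H) * w₁ * (p.2 : H ≃ₗ[ℂ] H)))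
    (hfree₂ : Function.Injective
      (fun p : ↥WM × ↥WL => (p.1 : H ≃ₗ[ℂ] H) * w₂ * (p.2 : H ≃ₗ[ℂ] H)))
    (hsep : ∀ s : H → ℂ,
      s ∈ Algebra.adjoin ℂ {f : H → ℂ | ∃ ℓ : Module.Dual ℂ H, f = ⇑ℓ} →
      (∀ u ∈ WL, ∀ l : H, s (u l) = s l) →
      ∀ l ∈ zm, s (w₁⁻¹ l) = s (w₂⁻¹ l)) :
    {x : H ≃ₗ[ℂ] H | ∃ a ∈ WM, ∃ b ∈ WL, x = a * w₁ * b}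
      = {x : H ≃ₗ[ℂ] H | ∃ a ∈ WM, ∃ b ∈ WL, x = a * w₂ * b} := by
  subst hW hWL hWM hzm
  have hΔspan : ⊤ ≤ Submodule.span ℂ (Δ : Set (Module.Dual ℂ H)) := by
    rw [← hΦspan, Submodule.span_le]
    intro β hβ
    have hmem : ∀ c : Module.Dual ℂ H → ℕ,
        ∑ α ∈ Δ, (c α : ℂ) • α ∈ Submodule.span ℂ (Δ : Set (Module.Dual ℂ H)) := fun c =>
      sum_mem fun α hα => Submodule.smul_mem _ _ (Submodule.subset_span hα)
    rcases hbase β hβ with ⟨c, rfl⟩ | ⟨c, rfl⟩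
    exacts [hmem c, neg_mem (hmem c)]
  obtain ⟨ω, hω1, hω0⟩ := exists_dual_family Δ hΔind hΔspan
  have hcoef : ∀ c : Module.Dual ℂ H → ℂ, ∀ γ ∈ Δ, (∑ α ∈ Δ, c α • α) (ω γ) = c γ := by
    intro c γ hγ
    rw [LinearMap.sum_apply, Finset.sum_eq_single_of_mem γ hγ]
    · simp [hω1 γ hγ]
    · intro α hα hne
      simp [hω0 α hα γ hγ hne]
  have h : IsBasedRootSystem Φ cv Δ sRefl ω :=
    { finite := hΦfin
      span_eq_top := hΦspan
      root_coroot_two := hcv2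
      sub_mem := hreflΦ
      exists_int := hcrys
      reduced := hred
      subset := fun α hα => hΔΦ hα
      apply_reflection := hsRefl
      coweight_self := hω1
      coweight_ne := hω0
      sum_coweight := by
        intro β
        obtain ⟨c, -, hc⟩ := Submodule.mem_span_finset.1
          (hΔspan (Submodule.mem_top : β ∈ (⊤ : Submodule ℂ (Module.Dual ℂ H))))
        subst hc
        exact Finset.sum_congr rfl fun γ hγ => by rw [hcoef c γ hγ]
      pos_or_neg := by
        intro β hβ
        rcases hbase β hβ with ⟨c, rfl⟩ | ⟨c, rfl⟩
        · exact Or.inl fun γ hγ => ⟨c γ, hcoef _ γ hγ⟩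
        · exact Or.inr fun γ hγ => ⟨c γ, by rw [LinearMap.neg_apply, hcoef _ γ hγ]⟩ }
  have hLle : Subgroup.closure (sRefl '' (ΔL : Set (Module.Dual ℂ H)))
      ≤ Subgroup.closure (sRefl '' Φ) :=
    Subgroup.closure_mono (Set.image_mono fun α hα => hΔΦ (hΔL hα))
  have := h.finite_of_le hLle
  classical
  let k : Module.Dual ℂ H → ℕ := fun γ => if γ ∈ ΔM then 0 else 1
  have hαl : ∀ α ∈ Δ, α (∑ γ ∈ Δ, (k γ : ℂ) • ω γ) = k α := by
    intro α hα
    rw [map_sum, Finset.sum_eq_single_of_mem α hα]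
    · simp [hω1 α hα]
    · intro γ hγ hne
      simp [hω0 α hα γ hγ hne.symm]
  obtain ⟨u, hu, hu'⟩ := exists_apply_eq_of_forall_invariant
    (Subgroup.closure (sRefl '' (ΔL : Set (Module.Dual ℂ H))))
    (w₁⁻¹ (∑ γ ∈ Δ, (k γ : ℂ) • ω γ)) (w₂⁻¹ (∑ γ ∈ Δ, (k γ : ℂ) • ω γ))
    fun s hs hinv => hsep s hs hinv _ fun α hα => (hαl α (hΔM hα)).trans (by simp [k, hα])
  obtain ⟨L, hL, hprod⟩ := h.exists_word (mul_mem (mul_mem hw₁ (hLle hu)) (inv_mem hw₂))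
  have hmem := h.mem_closure_of_apply_eq (T := ΔM) ⟨k, rfl⟩
    (fun α hα h0 => by
      rw [hαl α hα] at h0
      by_contra hαM
      simp only [Finset.mem_coe] at hαM
      simp [k, hαM] at h0) L.length L rfl hL
    (by
      rw [← hprod, LinearEquiv.mul_apply, LinearEquiv.mul_apply, ← hu']
      exact w₁.apply_symm_apply _)
  rw [← hprod] at hmem
  ext x
  constructor
  · rintro ⟨a, ha, b, hb, rfl⟩
    exact ⟨a * (w₁ * u * w₂⁻¹), mul_mem ha hmem, u⁻¹ * b, mul_mem (inv_mem hu) hb, by group⟩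
  · rintro ⟨a, ha, b, hb, rfl⟩
    exact ⟨a * (w₁ * u * w₂⁻¹)⁻¹, mul_mem ha (inv_mem hmem), u * b, mul_mem hu hb, by group⟩
end

section
/- Fix t ∈ ℂ with t ≠ 0, and let I'' ⊆ ℂ[x₁,x₂,x₃,x₄] be the ideal generated by (x_i² − t²)x_i for i = 1,…,4, by 2t² − (x₁² + x₂² + x₃² + x₄²), and by x_i x_j x_k for 1 ≤ i < j < k ≤ 4. Then the quotient algebra ℂ[x₁,x₂,x₃,x₄]/I'' has dimension 24 as a ℂ-vector space. -/
open MvPolynomial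

/-- The ideal `I'' ⊆ ℂ[x₁,x₂,x₃,x₄]` generated by `(x_i² − t²)x_i` for `i = 1,…,4`, by
`2t² − (x₁² + x₂² + x₃² + x₄²)`, and by `x_i x_j x_k` for `1 ≤ i < j < k ≤ 4`. -/
noncomputable def idealIpp (t : ℂ) : Ideal (MvPolynomial (Fin 4) ℂ) :=
  Ideal.span
    ((Set.range fun i : Fin 4 =>
        ((X i : MvPolynomial (Fin 4) ℂ) ^ 2 - C (t ^ 2)) * X i)
      ∪ {C (2 * t ^ 2) - (X 0 ^ 2 + X 1 ^ 2 + X 2 ^ 2 + X 3 ^ 2)}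
      ∪ {p : MvPolynomial (Fin 4) ℂ |
          ∃ i j k : Fin 4, i < j ∧ j < k ∧ p = X i * X j * X k})

/-- The three roots `0, t, -t` of `(x² - t²) x`. -/
def gridValue (t : ℂ) : Fin 3 → ℂ := ![0, t, -t]

/-- The Lagrange basis polynomials at the nodes `0, t, -t`, in the variable `X i`. -/
noncomputable def lagrangeFactor (t : ℂ) (i : Fin 4) : Fin 3 → MvPolynomial (Fin 4) ℂ :=
  ![1 - 2 * C ((2 * t ^ 2)⁻¹) * X i ^ 2,
    C ((2 * t ^ 2)⁻¹) * X i * (X i + C t),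
    C ((2 * t ^ 2)⁻¹) * X i * (X i - C t)]

/-- The polynomial taking the value `1` at the grid point `a` and `0` at the other grid points. -/
noncomputable def gridIndicator (t : ℂ) (a : Fin 4 → Fin 3) : MvPolynomial (Fin 4) ℂ :=
  ∏ i, lagrangeFactor t i (a i)

/-- The grid points with exactly two nonzero coordinates. -/
abbrev TwoSupported : Type :=
  {a : Fin 4 → Fin 3 // (Finset.univ.filter fun i => a i ≠ 0).card = 2}

theorem card_twoSupported : Fintype.card TwoSupported = 24 := by
  decide +kernel

theorem C_inv_mul_C {t : ℂ} (ht : t ≠ 0) :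
    (2 : MvPolynomial (Fin 4) ℂ) * C ((2 * t ^ 2)⁻¹) * C t ^ 2 = 1 := by
  have h : (2 : MvPolynomial (Fin 4) ℂ) = C 2 := (map_ofNat C 2).symm
  rw [h, ← C_pow, ← C_mul, ← C_mul, ← C_1]
  congr 1
  field_simp

theorem sum_lagrangeFactor (t : ℂ) (i : Fin 4) : ∑ c, lagrangeFactor t i c = 1 := by
  simp only [lagrangeFactor, Fin.sum_univ_three, Matrix.cons_val]
  ring

theorem sum_gridIndicator (t : ℂ) : ∑ a, gridIndicator t a = 1 := by
  have h := Finset.prod_univ_sum (fun _ : Fin 4 => (Finset.univ : Finset (Fin 3)))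
    (fun i c => lagrangeFactor t i c)
  simp only [sum_lagrangeFactor, Finset.prod_const_one, Fintype.piFinset_univ] at h
  exact h.symm

theorem eval_lagrangeFactor {t : ℂ} (ht : t ≠ 0) (a : Fin 4 → Fin 3) (i : Fin 4) (c : Fin 3) :
    eval (fun j => gridValue t (a j)) (lagrangeFactor t i c) = if a i = c then 1 else 0 := by
  generalize hd : a i = d
  fin_cases d <;> fin_cases c <;> simp [lagrangeFactor, gridValue, hd] <;> field_simp <;> norm_num

theorem eval_gridIndicator {t : ℂ} (ht : t ≠ 0) (a b : Fin 4 → Fin 3) :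
    eval (fun j => gridValue t (a j)) (gridIndicator t b) = if a = b then 1 else 0 := by
  simp only [gridIndicator, map_prod, eval_lagrangeFactor ht]
  rw [Fintype.prod_ite_zero]
  simp [funext_iff]

theorem X_sub_mul_gridIndicator_mem {t : ℂ} (ht : t ≠ 0) (a : Fin 4 → Fin 3) (i : Fin 4) :
    (X i - C (gridValue t (a i))) * gridIndicator t a ∈ idealIpp t := by
  have hgen : ((X i : MvPolynomial (Fin 4) ℂ) ^ 2 - C (t ^ 2)) * X i ∈ idealIpp t :=
    Ideal.subset_span (Or.inl (Or.inl ⟨i, rfl⟩))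
  have hdvd : ((X i : MvPolynomial (Fin 4) ℂ) ^ 2 - C (t ^ 2)) * X i ∣
      (X i - C (gridValue t (a i))) * lagrangeFactor t i (a i) := by
    have h := C_inv_mul_C ht
    generalize a i = d
    fin_cases d <;> simp [lagrangeFactor, gridValue]
    · exact ⟨-2 * C ((2 * t ^ 2)⁻¹), by simp at h ⊢; linear_combination -X i * h⟩
    · exact ⟨C ((2 * t ^ 2)⁻¹), by simp; ring⟩
    · exact ⟨C ((2 * t ^ 2)⁻¹), by simp; ring⟩
  refine Ideal.mem_of_dvd _ (hdvd.trans (mul_dvd_mul_left _ ?_)) hgen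
  exact Finset.dvd_prod_of_mem (fun j => lagrangeFactor t j (a j)) (Finset.mem_univ i)

theorem sub_eval_mul_gridIndicator_mem {t : ℂ} (ht : t ≠ 0) (a : Fin 4 → Fin 3)
    (p : MvPolynomial (Fin 4) ℂ) :
    (p - C (eval (fun j => gridValue t (a j)) p)) * gridIndicator t a ∈ idealIpp t := by
  induction p using MvPolynomial.induction_on with
  | C c => simp
  | add p q hp hq =>
    convert add_mem hp hq using 1
    simp only [map_add]
    ring
  | mul_X p i hp =>
    convert add_mem (Ideal.mul_mem_left _ (X i) hp)
      (Ideal.mul_mem_left _ (C (eval (fun j => gridValue t (a j)) p))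
        (X_sub_mul_gridIndicator_mem ht a i)) using 1
    simp only [map_mul, eval_X]
    ring

theorem gridValue_sq (t : ℂ) (c : Fin 3) : gridValue t c ^ 2 = if c ≠ 0 then t ^ 2 else 0 := by
  fin_cases c <;> simp [gridValue]

theorem eval_sum_sq (t : ℂ) (a : Fin 4 → Fin 3) :
    eval (fun j => gridValue t (a j))
        (C (2 * t ^ 2) - (X 0 ^ 2 + X 1 ^ 2 + X 2 ^ 2 + X 3 ^ 2)) =
      (2 - ((Finset.univ.filter fun i => a i ≠ 0).card : ℂ)) * t ^ 2 := by
  have h : ∑ i, gridValue t (a i) ^ 2 =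
      ((Finset.univ.filter fun i => a i ≠ 0).card : ℂ) * t ^ 2 := by
    simp only [gridValue_sq]
    rw [← Finset.sum_filter, Finset.sum_const, nsmul_eq_mul]
  rw [Fin.sum_univ_four] at h
  simp only [map_sub, map_add, map_pow, eval_X, eval_C]
  linear_combination -h

theorem gridIndicator_mem {t : ℂ} (ht : t ≠ 0) {a : Fin 4 → Fin 3}
    (ha : (Finset.univ.filter fun i => a i ≠ 0).card ≠ 2) :
    gridIndicator t a ∈ idealIpp t := by
  have hgen : (C (2 * t ^ 2) - (X 0 ^ 2 + X 1 ^ 2 + X 2 ^ 2 + X 3 ^ 2) :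
      MvPolynomial (Fin 4) ℂ) ∈ idealIpp t :=
    Ideal.subset_span (Or.inl (Or.inr rfl))
  have h := sub_mem (Ideal.mul_mem_right (gridIndicator t a) _ hgen)
    (sub_eval_mul_gridIndicator_mem ht a
      (C (2 * t ^ 2) - (X 0 ^ 2 + X 1 ^ 2 + X 2 ^ 2 + X 3 ^ 2)))
  rw [← sub_mul, sub_sub_cancel, eval_sum_sq] at h
  have hne : (2 - ((Finset.univ.filter fun i => a i ≠ 0).card : ℂ)) * t ^ 2 ≠ 0 :=
    mul_ne_zero (sub_ne_zero.2 fun h2 => ha (by exact_mod_cast h2.symm)) (pow_ne_zero 2 ht)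
  have h' := Ideal.mul_mem_left _
    (C ((2 - ((Finset.univ.filter fun i => a i ≠ 0).card : ℂ)) * t ^ 2)⁻¹) h
  rwa [← mul_assoc, ← C_mul, inv_mul_cancel₀ hne, C_1, one_mul] at h'

/-- Evaluation at the grid points with exactly two nonzero coordinates. -/
noncomputable def gridEval (t : ℂ) : MvPolynomial (Fin 4) ℂ →ₐ[ℂ] (TwoSupported → ℂ) :=
  AlgHom.pi fun a => aeval fun j => gridValue t (a.1 j)

theorem gridEval_apply (t : ℂ) (p : MvPolynomial (Fin 4) ℂ) (a : TwoSupported) :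
    gridEval t p a = eval (fun j => gridValue t (a.1 j)) p := by
  simp [gridEval, aeval_eq_eval]

theorem gridEval_surjective {t : ℂ} (ht : t ≠ 0) : Function.Surjective (gridEval t) := by
  intro f
  refine ⟨∑ b : TwoSupported, C (f b) * gridIndicator t b.1, ?_⟩
  ext a
  simp [gridEval_apply, eval_gridIndicator ht, ← Subtype.ext_iff]

theorem ker_gridEval {t : ℂ} (ht : t ≠ 0) : RingHom.ker (gridEval t) = idealIpp t := by
  apply le_antisymm
  · intro p hp
    have hp0 (a : TwoSupported) : eval (fun j => gridValue t (a.1 j)) p = 0 := by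
      rw [← gridEval_apply, RingHom.mem_ker.1 hp, Pi.zero_apply]
    rw [← mul_one p, ← sum_gridIndicator t, Finset.mul_sum]
    refine sum_mem fun a _ => ?_
    by_cases ha : (Finset.univ.filter fun i => a i ≠ 0).card = 2
    · simpa [hp0 ⟨a, ha⟩] using sub_eval_mul_gridIndicator_mem ht a p
    · exact Ideal.mul_mem_left _ _ (gridIndicator_mem ht ha)
  · refine Ideal.span_le.2 fun p hp => RingHom.mem_ker.2 (funext fun a => ?_)
    rw [gridEval_apply, Pi.zero_apply]
    rcases hp with (⟨i, rfl⟩ | rfl) | ⟨i, j, k, hij, hjk, rfl⟩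
    · simp only [map_mul, map_sub, map_pow, eval_X, eval_C, gridValue_sq]
      generalize a.1 i = c
      fin_cases c <;> simp [gridValue]
    · rw [eval_sum_sq, a.2]
      simp
    · by_contra h
      simp only [map_mul, eval_X, mul_ne_zero_iff, ← ne_eq] at h
      have hne {l : Fin 4} (hl : gridValue t (a.1 l) ≠ 0) : a.1 l ≠ 0 := by
        intro h0
        simp [h0, gridValue] at hl
      have hsub : ({i, j, k} : Finset (Fin 4)) ⊆ Finset.univ.filter fun l => a.1 l ≠ 0 := by
        intro l hl
        simp only [Finset.mem_insert, Finset.mem_singleton] at hl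
        rcases hl with rfl | rfl | rfl
        · simpa using hne h.1.1
        · simpa using hne h.1.2
        · simpa using hne h.2
      have hcard := Finset.card_le_card hsub
      rw [a.2, Finset.card_eq_three.2 ⟨i, j, k, hij.ne, (hij.trans hjk).ne, hjk.ne, rfl⟩] at hcard
      omega

/-- For `t ≠ 0`, the quotient algebra `ℂ[x₁,x₂,x₃,x₄]/I''` has dimension `24` as a
`ℂ`-vector space. -/
theorem stmt9 (t : ℂ) (ht : t ≠ 0) :
    Module.finrank ℂ (MvPolynomial (Fin 4) ℂ ⧸ idealIpp t) = 24 := by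
  rw [← ker_gridEval ht,
    (Ideal.quotientKerAlgEquivOfSurjective (gridEval_surjective ht)).toLinearEquiv.finrank_eq,
    Module.finrank_fintype_fun_eq_card, card_twoSupported]
end

section
/- Fix t ∈ ℂ with t ≠ 0, let I'' ⊆ ℂ[x₁,x₂,x₃,x₄] be the ideal generated by (x_i² − t²)x_i for i = 1,…,4, by 2t² − (x₁² + x₂² + x₃² + x₄²), and by x_i x_j x_k for 1 ≤ i < j < k ≤ 4, and let gr I'' be the homogeneous ideal generated by the top-degree homogeneous components of the nonzero elements of I''. Then the images of the 24 monomials 1; x₁, x₂, x₃, x₄; x₁², x₂², x₃²; x_i x_j for 1 ≤ i < j ≤ 4; x₁x₂², x₁x₃², x₂x₃², x₂x₄², x₃x₄², x₃x₁², x₄x₁², x₄x₂²; x₁²x₂², x₂²x₃² form a ℂ-basis of the quotient ℂ[x₁,x₂,x₃,x₄]/gr I''. -/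
open MvPolynomial

/-- `gr I''`: the homogeneous ideal generated by the top-degree homogeneous components of the
nonzero elements of `I''`. -/
noncomputable def grIdealIpp (t : ℂ) : Ideal (MvPolynomial (Fin 4) ℂ) :=
  Ideal.span {q : MvPolynomial (Fin 4) ℂ |
    ∃ p ∈ idealIpp t, p ≠ 0 ∧ q = homogeneousComponent p.totalDegree p}

/-- The 24 monomials `1; x₁, x₂, x₃, x₄; x₁², x₂², x₃²; x_i x_j (i<j); x₁x₂², x₁x₃², x₂x₃²,
x₂x₄², x₃x₄², x₃x₁², x₄x₁², x₄x₂²; x₁²x₂², x₂²x₃²` (here with `0`-based indices). -/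
noncomputable def basisMonomials : Fin 24 → MvPolynomial (Fin 4) ℂ :=
  ![1, X 0, X 1, X 2, X 3,
    X 0 ^ 2, X 1 ^ 2, X 2 ^ 2,
    X 0 * X 1, X 0 * X 2, X 0 * X 3, X 1 * X 2, X 1 * X 3, X 2 * X 3,
    X 0 * X 1 ^ 2, X 0 * X 2 ^ 2, X 1 * X 2 ^ 2, X 1 * X 3 ^ 2, X 2 * X 3 ^ 2,
    X 2 * X 0 ^ 2, X 3 * X 0 ^ 2, X 3 * X 1 ^ 2,
    X 0 ^ 2 * X 1 ^ 2, X 1 ^ 2 * X 2 ^ 2]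

/-- The exponent vectors of `basisMonomials`. -/
def basisExponent : Fin 24 → Fin 4 → ℕ :=
  ![![0, 0, 0, 0], ![1, 0, 0, 0], ![0, 1, 0, 0], ![0, 0, 1, 0], ![0, 0, 0, 1],
    ![2, 0, 0, 0], ![0, 2, 0, 0], ![0, 0, 2, 0],
    ![1, 1, 0, 0], ![1, 0, 1, 0], ![1, 0, 0, 1], ![0, 1, 1, 0], ![0, 1, 0, 1], ![0, 0, 1, 1],
    ![1, 2, 0, 0], ![1, 0, 2, 0], ![0, 1, 2, 0], ![0, 1, 0, 2], ![0, 0, 1, 2],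
    ![2, 0, 1, 0], ![2, 0, 0, 1], ![0, 2, 0, 1],
    ![2, 2, 0, 0], ![0, 2, 2, 0]]

/-- The degrees of `basisMonomials`. -/
def basisDegree (i : Fin 24) : ℕ := ∑ k, basisExponent i k

/-- The zeros of `I''` for `t = 1`: the vectors with entries in `{0, 1, -1}` having exactly two
nonzero entries. -/
def zeroPoint : Fin 24 → Fin 4 → ℤ :=
  ![![1, 1, 0, 0], ![1, -1, 0, 0], ![-1, 1, 0, 0], ![-1, -1, 0, 0],
    ![1, 0, 1, 0], ![1, 0, -1, 0], ![-1, 0, 1, 0], ![-1, 0, -1, 0],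
    ![1, 0, 0, 1], ![1, 0, 0, -1], ![-1, 0, 0, 1], ![-1, 0, 0, -1],
    ![0, 1, 1, 0], ![0, 1, -1, 0], ![0, -1, 1, 0], ![0, -1, -1, 0],
    ![0, 1, 0, 1], ![0, 1, 0, -1], ![0, -1, 0, 1], ![0, -1, 0, -1],
    ![0, 0, 1, 1], ![0, 0, 1, -1], ![0, 0, -1, 1], ![0, 0, -1, -1]]

/-- Weights on the zeros of `I''` defining, up to scaling, the functionals dual to
`basisMonomials`. -/
def dualWeight (i : Fin 24) (x : Fin 4 → ℤ) : ℤ :=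
  ![x 0 ^ 2 * x 3 ^ 2 + x 2 ^ 2 * x 3 ^ 2 - x 0 ^ 2 * x 2 ^ 2,
    x 0 * x 3 ^ 2, x 1 * x 0 ^ 2, x 2 * x 1 ^ 2, x 3 * x 2 ^ 2,
    x 0 ^ 2 * x 2 ^ 2 - x 2 ^ 2 * x 3 ^ 2,
    x 1 ^ 2 * x 3 ^ 2 + x 0 ^ 2 * x 2 ^ 2 - x 0 ^ 2 * x 3 ^ 2 - x 2 ^ 2 * x 3 ^ 2,
    x 0 ^ 2 * x 2 ^ 2 - x 0 ^ 2 * x 3 ^ 2,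
    x 0 * x 1, x 0 * x 2, x 0 * x 3, x 1 * x 2, x 1 * x 3, x 2 * x 3,
    x 0 * (x 1 ^ 2 - x 3 ^ 2), x 0 * (x 2 ^ 2 - x 3 ^ 2),
    x 1 * (x 2 ^ 2 - x 0 ^ 2), x 1 * (x 3 ^ 2 - x 0 ^ 2),
    x 2 * (x 3 ^ 2 - x 1 ^ 2), x 2 * (x 0 ^ 2 - x 1 ^ 2),
    x 3 * (x 0 ^ 2 - x 2 ^ 2), x 3 * (x 1 ^ 2 - x 2 ^ 2),
    x 0 ^ 2 * x 1 ^ 2 + x 2 ^ 2 * x 3 ^ 2 - x 0 ^ 2 * x 2 ^ 2 - x 1 ^ 2 * x 3 ^ 2,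
    x 0 ^ 2 * x 3 ^ 2 + x 1 ^ 2 * x 2 ^ 2 - x 0 ^ 2 * x 2 ^ 2 - x 1 ^ 2 * x 3 ^ 2] i

lemma zeroPoint_cube (p : Fin 24) (i : Fin 4) : zeroPoint p i ^ 3 = zeroPoint p i := by
  revert p i; decide +kernel

lemma sum_zeroPoint_sq (p : Fin 24) :
    zeroPoint p 0 ^ 2 + zeroPoint p 1 ^ 2 + zeroPoint p 2 ^ 2 + zeroPoint p 3 ^ 2 = 2 := by
  revert p; decide +kernel

lemma zeroPoint_mul_mul (p : Fin 24) (i j k : Fin 4) (hij : i < j) (hjk : j < k) :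
    zeroPoint p i * zeroPoint p j * zeroPoint p k = 0 := by
  revert p i j k; decide +kernel

lemma sum_dualWeight_basisExponent (i j : Fin 24) (h : basisDegree j = basisDegree i) :
    ∑ p, dualWeight i (zeroPoint p) * ∏ k, zeroPoint p k ^ basisExponent j k =
      if i = j then 4 else 0 := by
  revert i j; decide +kernel

lemma basisDegree_le (i : Fin 24) : basisDegree i ≤ 4 := by
  revert i; decide +kernel

lemma sum_dualWeight_fin (i : Fin 24) (a : Fin 4 → Fin 4)
    (h : ∑ k, (a k : ℕ) < basisDegree i) :
    ∑ p, dualWeight i (zeroPoint p) * ∏ k, zeroPoint p k ^ (a k : ℕ) = 0 := by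
  revert i a; decide +kernel

lemma sum_dualWeight_of_lt (i : Fin 24) (a : Fin 4 → ℕ) (h : ∑ k, a k < basisDegree i) :
    ∑ p, dualWeight i (zeroPoint p) * ∏ k, zeroPoint p k ^ a k = 0 := by
  have ha (k : Fin 4) : a k < 4 :=
    (Finset.single_le_sum (f := a) (fun _ _ => Nat.zero_le _) (Finset.mem_univ k)).trans_lt
      (h.trans_le (basisDegree_le i))
  exact sum_dualWeight_fin i (fun k => ⟨a k, ha k⟩) h

lemma basisMonomials_eq_prod (i : Fin 24) :
    _root_.basisMonomials i = ∏ k, X k ^ basisExponent i k := by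
  fin_cases i <;> simp [_root_.basisMonomials, basisExponent, Fin.prod_univ_four, mul_comm]

lemma isHomogeneous_basisMonomials (i : Fin 24) :
    (_root_.basisMonomials i).IsHomogeneous (basisDegree i) := by
  rw [basisMonomials_eq_prod]
  exact IsHomogeneous.prod _ _ _ fun k _ => isHomogeneous_X_pow k _

/-- Up to scaling, the functional on `ℂ[x₁,x₂,x₃,x₄] / I''` dual to `basisMonomials i`. -/
noncomputable def dualFunctional (t : ℂ) (i : Fin 24) : MvPolynomial (Fin 4) ℂ →ₗ[ℂ] ℂ :=
  ∑ p, (dualWeight i (zeroPoint p) : ℂ) • (aeval fun k => t * (zeroPoint p k : ℂ)).toLinearMap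

lemma dualFunctional_apply (t : ℂ) (i : Fin 24) (f : MvPolynomial (Fin 4) ℂ) :
    dualFunctional t i f =
      ∑ p, (dualWeight i (zeroPoint p) : ℂ) * eval (fun k => t * (zeroPoint p k : ℂ)) f := by
  simp [dualFunctional, aeval_eq_eval]

lemma eval_zeroPoint_of_mem (t : ℂ) (p : Fin 24) {f : MvPolynomial (Fin 4) ℂ}
    (hf : f ∈ idealIpp t) : eval (fun k => t * (zeroPoint p k : ℂ)) f = 0 := by
  suffices h : idealIpp t ≤ RingHom.ker (eval fun k => t * (zeroPoint p k : ℂ)) from h hf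
  refine Ideal.span_le.2 ?_
  rintro _ ((⟨i, rfl⟩ | rfl) | ⟨i, j, k, hij, hjk, rfl⟩)
  · have h : (zeroPoint p i : ℂ) ^ 3 = zeroPoint p i := mod_cast zeroPoint_cube p i
    simp only [SetLike.mem_coe, RingHom.mem_ker, map_mul, map_sub, map_pow, eval_X, eval_C]
    linear_combination t ^ 3 * h
  · have h : (zeroPoint p 0 : ℂ) ^ 2 + (zeroPoint p 1 : ℂ) ^ 2 + (zeroPoint p 2 : ℂ) ^ 2 +
        (zeroPoint p 3 : ℂ) ^ 2 = 2 := mod_cast sum_zeroPoint_sq p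
    simp only [SetLike.mem_coe, RingHom.mem_ker, map_add, map_sub, map_pow, eval_X, eval_C]
    linear_combination -t ^ 2 * h
  · have h : (zeroPoint p i : ℂ) * zeroPoint p j * zeroPoint p k = 0 :=
      mod_cast zeroPoint_mul_mul p i j k hij hjk
    simp only [SetLike.mem_coe, RingHom.mem_ker, map_mul, eval_X]
    linear_combination t ^ 3 * h

lemma dualFunctional_of_mem (t : ℂ) (i : Fin 24) {f : MvPolynomial (Fin 4) ℂ}
    (hf : f ∈ idealIpp t) : dualFunctional t i f = 0 := by
  simp [dualFunctional_apply, eval_zeroPoint_of_mem t _ hf]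

lemma sum_dualWeight_mul_prod (t : ℂ) (i : Fin 24) (a : Fin 4 → ℕ) :
    ∑ p, (dualWeight i (zeroPoint p) : ℂ) * ∏ k, (t * (zeroPoint p k : ℂ)) ^ a k =
      t ^ (∑ k, a k) *
        ((∑ p, dualWeight i (zeroPoint p) * ∏ k, zeroPoint p k ^ a k : ℤ) : ℂ) := by
  push_cast
  rw [Finset.mul_sum]
  refine Finset.sum_congr rfl fun p _ => ?_
  simp only [mul_pow, Finset.prod_mul_distrib, Finset.prod_pow_eq_pow_sum]
  ring

lemma dualFunctional_of_support_degree_lt (t : ℂ) (i : Fin 24) {f : MvPolynomial (Fin 4) ℂ}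
    (hf : ∀ s ∈ f.support, ∑ k, s k < basisDegree i) : dualFunctional t i f = 0 := by
  simp only [dualFunctional_apply, eval_eq', Finset.mul_sum]
  rw [Finset.sum_comm]
  refine Finset.sum_eq_zero fun s hs => ?_
  have h := sum_dualWeight_mul_prod t i s
  rw [sum_dualWeight_of_lt i s (hf s hs), Int.cast_zero, mul_zero] at h
  rw [← mul_zero (coeff s f), ← h, Finset.mul_sum]
  exact Finset.sum_congr rfl fun p _ => by ring

lemma dualFunctional_basisMonomials (t : ℂ) (i j : Fin 24) (h : basisDegree j = basisDegree i) :
    dualFunctional t i (_root_.basisMonomials j) = if i = j then 4 * t ^ basisDegree i else 0 := by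
  have h' := sum_dualWeight_mul_prod t i (basisExponent j)
  rw [sum_dualWeight_basisExponent i j h] at h'
  simp only [dualFunctional_apply, basisMonomials_eq_prod, map_prod, map_pow, eval_X, h']
  rw [← h, basisDegree]
  split_ifs <;> simp [mul_comm]

/-- Up to scaling, the functional on `ℂ[x₁,x₂,x₃,x₄] / gr I''` dual to `basisMonomials i`. -/
noncomputable def grDualFunctional (t : ℂ) (i : Fin 24) : MvPolynomial (Fin 4) ℂ →ₗ[ℂ] ℂ :=
  dualFunctional t i ∘ₗ homogeneousComponent (basisDegree i)

lemma grDualFunctional_basisMonomials (t : ℂ) (i j : Fin 24) :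
    grDualFunctional t i (_root_.basisMonomials j) = if i = j then 4 * t ^ basisDegree i else 0 := by
  rw [grDualFunctional, LinearMap.comp_apply,
    homogeneousComponent_of_mem (isHomogeneous_basisMonomials j)]
  split_ifs with h h' h'
  · rw [dualFunctional_basisMonomials t i j h.symm, if_pos h']
  · rw [dualFunctional_basisMonomials t i j h.symm, if_neg h']
  · exact absurd (h' ▸ rfl) h
  · exact map_zero _

lemma dualFunctional_mul_leadingForm (t : ℂ) (i : Fin 24) {r f : MvPolynomial (Fin 4) ℂ}
    {n : ℕ} (hr : r.IsHomogeneous n) (hn : n + f.totalDegree = basisDegree i)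
    (hf : f ∈ idealIpp t) :
    dualFunctional t i (r * homogeneousComponent f.totalDegree f) = 0 := by
  have hlow : dualFunctional t i (r * (f - homogeneousComponent f.totalDegree f)) = 0 := by
    refine dualFunctional_of_support_degree_lt t i fun s hs => ?_
    obtain ⟨a, ha, b, hb, rfl⟩ := Finset.mem_add.1 (support_mul _ _ hs)
    have ha' : ∑ k, a k = n := by
      rw [← Finsupp.degree_eq_sum]
      by_contra hne
      exact (mem_support_iff.1 ha) (hr.coeff_eq_zero hne)
    have hb' : ∑ k, b k < f.totalDegree := by
      rw [← Finsupp.degree_eq_sum]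
      rw [mem_support_iff, coeff_sub, coeff_homogeneousComponent] at hb
      have hne : b.degree ≠ f.totalDegree := fun h => hb (by rw [if_pos h, sub_self])
      rw [if_neg hne, sub_zero] at hb
      refine lt_of_le_of_ne ?_ hne
      have := le_totalDegree (mem_support_iff.2 hb)
      rwa [Finsupp.degree]
    simp only [Finsupp.add_apply, Finset.sum_add_distrib]
    omega
  rw [mul_sub, map_sub, dualFunctional_of_mem t i (Ideal.mul_mem_left _ r hf)] at hlow
  simpa using hlow

lemma grDualFunctional_mul_leadingForm (t : ℂ) (i : Fin 24) (r : MvPolynomial (Fin 4) ℂ)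
    {f : MvPolynomial (Fin 4) ℂ} (hf : f ∈ idealIpp t) :
    grDualFunctional t i (r * homogeneousComponent f.totalDegree f) = 0 := by
  rw [← sum_homogeneousComponent r, Finset.sum_mul, map_sum]
  refine Finset.sum_eq_zero fun n _ => ?_
  have hr := homogeneousComponent_isHomogeneous n r
  rw [grDualFunctional, LinearMap.comp_apply, homogeneousComponent_of_mem
    (hr.mul (homogeneousComponent_isHomogeneous f.totalDegree f))]
  split_ifs with h
  · exact dualFunctional_mul_leadingForm t i hr h.symm hf
  · exact map_zero _

lemma grDualFunctional_of_mem (t : ℂ) (i : Fin 24) {f : MvPolynomial (Fin 4) ℂ}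
    (hf : f ∈ grIdealIpp t) : grDualFunctional t i f = 0 := by
  suffices h : ∀ r, grDualFunctional t i (r * f) = 0 by simpa using h 1
  induction hf using Submodule.span_induction with
  | zero => simp
  | add f g _ _ hf hg => intro r; rw [mul_add, map_add, hf, hg, add_zero]
  | mem f hf =>
    obtain ⟨p, hp, -, rfl⟩ := hf
    exact fun r => grDualFunctional_mul_leadingForm t i r hp
  | smul a f _ hf => intro r; rw [smul_eq_mul, ← mul_assoc, hf]

lemma linearIndependent_basisMonomials (t : ℂ) (ht : t ≠ 0) :
    LinearIndependent ℂ
      (fun i : Fin 24 => Ideal.Quotient.mk (grIdealIpp t) (_root_.basisMonomials i)) := by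
  rw [Fintype.linearIndependent_iff]
  intro c hc i
  have hmem : ∑ j, c j • _root_.basisMonomials j ∈ grIdealIpp t := by
    rw [← Ideal.Quotient.eq_zero_iff_mem, ← hc, map_sum]
    rfl
  have h := grDualFunctional_of_mem t i hmem
  simpa [grDualFunctional_basisMonomials, ht] using h

lemma mem_grIdealIpp_of_add_mem (t : ℂ) {q r : MvPolynomial (Fin 4) ℂ} {d : ℕ}
    (hq : q.IsHomogeneous d) (hr : r.totalDegree < d) (h : q + r ∈ idealIpp t) :
    q ∈ grIdealIpp t := by
  by_cases hq0 : q = 0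
  · exact hq0 ▸ zero_mem _
  have hdeg : (q + r).totalDegree = d := by
    rw [totalDegree_add_eq_left_of_totalDegree_lt (by rwa [hq.totalDegree hq0]),
      hq.totalDegree hq0]
  refine Ideal.subset_span ⟨q + r, h, ?_, ?_⟩
  · intro h0
    rw [h0, totalDegree_zero] at hdeg
    omega
  · rw [hdeg, map_add, homogeneousComponent_eq_self hq, homogeneousComponent_eq_zero _ _ hr,
      add_zero]

lemma X_pow_three_mem (t : ℂ) (i : Fin 4) : X i ^ 3 ∈ grIdealIpp t := by
  refine mem_grIdealIpp_of_add_mem t (r := C (-t ^ 2) * X i) (isHomogeneous_X_pow i 3) ?_ ?_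
  · exact (totalDegree_mul _ _).trans_lt (by rw [totalDegree_C, totalDegree_X]; norm_num)
  · have h : (X i ^ 2 - C (t ^ 2)) * X i ∈ idealIpp t :=
      Ideal.subset_span (Or.inl (Or.inl ⟨i, rfl⟩))
    convert h using 1
    rw [C_neg]
    ring

lemma sum_X_sq_mem (t : ℂ) : X 0 ^ 2 + X 1 ^ 2 + X 2 ^ 2 + X 3 ^ 2 ∈ grIdealIpp t := by
  refine mem_grIdealIpp_of_add_mem t (r := C (-(2 * t ^ 2))) (d := 2) ?_ ?_ ?_
  · exact (((isHomogeneous_X_pow 0 2).add (isHomogeneous_X_pow 1 2)).add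
      (isHomogeneous_X_pow 2 2)).add (isHomogeneous_X_pow 3 2)
  · rw [totalDegree_C]
    norm_num
  · have h : C (2 * t ^ 2) - (X 0 ^ 2 + X 1 ^ 2 + X 2 ^ 2 + X 3 ^ 2) ∈ idealIpp t :=
      Ideal.subset_span (Or.inl (Or.inr rfl))
    convert neg_mem h using 1
    rw [C_neg]
    ring

lemma X_mul_X_mul_X_mem (t : ℂ) {i j k : Fin 4} (hij : i < j) (hjk : j < k) :
    X i * X j * X k ∈ grIdealIpp t := by
  refine mem_grIdealIpp_of_add_mem t (r := 0) (d := 3)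
    (((isHomogeneous_X ℂ i).mul (isHomogeneous_X ℂ j)).mul (isHomogeneous_X ℂ k)) (by simp) ?_
  rw [add_zero]
  exact Ideal.subset_span (Or.inr ⟨i, j, k, hij, hjk, rfl⟩)

lemma mul_mul_eq_zero_of_ne {A : Type*} [CommRing A] {x : Fin 4 → A}
    (htriple : ∀ i j k, i < j → j < k → x i * x j * x k = 0) {i j k : Fin 4}
    (hij : i ≠ j) (hjk : j ≠ k) (hik : i ≠ k) : x i * x j * x k = 0 := by
  rcases lt_or_gt_of_ne hij with h₁ | h₁ <;> rcases lt_or_gt_of_ne hjk with h₂ | h₂ <;>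
    rcases lt_or_gt_of_ne hik with h₃ | h₃
  · exact htriple i j k h₁ h₂
  · omega
  · linear_combination htriple i k j h₃ h₂
  · linear_combination htriple k i j h₃ h₁
  · linear_combination htriple j i k h₁ h₃
  · linear_combination htriple j k i h₂ h₃
  · omega
  · linear_combination htriple k j i h₂ h₁

/-- The monomials in which at most two variables occur and no exponent exceeds `2`. -/
inductive IsPairMonomial {A : Type*} [CommRing A] (x : Fin 4 → A) : A → Prop
  | one : IsPairMonomial x 1
  | var (i) : IsPairMonomial x (x i)
  | mul (i j) : IsPairMonomial x (x i * x j)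
  | mul_sq (i j) : i ≠ j → IsPairMonomial x (x i * x j ^ 2)
  | sq_mul_sq (i j) : i ≠ j → IsPairMonomial x (x i ^ 2 * x j ^ 2)

lemma IsPairMonomial.mul_var {A : Type*} [CommRing A] {x : Fin 4 → A}
    (hcube : ∀ i, x i ^ 3 = 0) (htriple : ∀ i j k, i < j → j < k → x i * x j * x k = 0)
    {a : A} (ha : IsPairMonomial x a) (k : Fin 4) :
    a * x k = 0 ∨ IsPairMonomial x (a * x k) := by
  cases ha with
  | one => exact .inr (by simpa using .var k)
  | var i => exact .inr (.mul i k)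
  | mul i j =>
    by_cases hij : i = j
    · subst hij
      by_cases hik : k = i
      · exact .inl (by rw [hik]; linear_combination hcube i)
      · exact .inr (by convert IsPairMonomial.mul_sq (x := x) k i hik using 1; ring)
    by_cases hik : i = k
    · subst hik
      exact .inr (by convert IsPairMonomial.mul_sq (x := x) j i (Ne.symm hij) using 1; ring)
    by_cases hjk : j = k
    · subst hjk
      exact .inr (by convert IsPairMonomial.mul_sq (x := x) i j hij using 1; ring)
    exact .inl (mul_mul_eq_zero_of_ne htriple hij hjk hik)
  | mul_sq i j hij =>
    by_cases hik : i = k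
    · subst hik
      exact .inr (by convert IsPairMonomial.sq_mul_sq (x := x) i j hij using 1; ring)
    by_cases hjk : j = k
    · subst hjk
      exact .inl (by linear_combination x i * hcube j)
    exact .inl (by linear_combination x j * mul_mul_eq_zero_of_ne htriple hij hjk hik)
  | sq_mul_sq i j hij =>
    by_cases hik : i = k
    · subst hik
      exact .inl (by linear_combination x j ^ 2 * hcube i)
    by_cases hjk : j = k
    · subst hjk
      exact .inl (by linear_combination x i ^ 2 * hcube j)
    exact .inl (by linear_combination x i * x j * mul_mul_eq_zero_of_ne htriple hij hjk hik)

lemma aeval_mem_span_isPairMonomial {A : Type*} [CommRing A] [Algebra ℂ A] {x : Fin 4 → A}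
    (hcube : ∀ i, x i ^ 3 = 0) (htriple : ∀ i j k, i < j → j < k → x i * x j * x k = 0)
    (f : MvPolynomial (Fin 4) ℂ) :
    aeval x f ∈ Submodule.span ℂ {a | IsPairMonomial x a} := by
  induction f using MvPolynomial.induction_on with
  | C c =>
    rw [aeval_C, Algebra.algebraMap_eq_smul_one]
    exact Submodule.smul_mem _ _ (Submodule.subset_span .one)
  | add p q hp hq => rw [map_add]; exact add_mem hp hq
  | mul_X p k hp =>
    rw [map_mul, aeval_X]
    generalize aeval x p = b at hp
    induction hp using Submodule.span_induction with
    | zero => rw [zero_mul]; exact zero_mem _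
    | add a b _ _ ha hb => rw [add_mul]; exact add_mem ha hb
    | smul c a _ ha => rw [smul_mul_assoc]; exact Submodule.smul_mem _ _ ha
    | mem a ha =>
      rcases ha.mul_var hcube htriple k with h | h
      · rw [h]; exact zero_mem _
      · exact Submodule.subset_span h

lemma pairMonomial_mem_of_sum_sq {A : Type*} [CommRing A] [Algebra ℂ A] {x : Fin 4 → A}
    (hcube : ∀ i, x i ^ 3 = 0) (hsum : x 0 ^ 2 + x 1 ^ 2 + x 2 ^ 2 + x 3 ^ 2 = 0)
    {S : Submodule ℂ A} (hS : ∀ i, ∏ k, x k ^ basisExponent i k ∈ S) {a : A}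
    (ha : IsPairMonomial x a) : a ∈ S := by
  have hdbl {a b : A} (h : 2 * a = 2 * b) : a = b := by
    have h2 : (2 : ℂ) • a = (2 : ℂ) • b := by rw [two_smul, two_smul, ← two_mul, h, two_mul]
    exact smul_right_injective A two_ne_zero h2
  have c0 := hcube 0
  have c1 := hcube 1
  have c2 := hcube 2
  have c3 := hcube 3
  have s3 : x 3 ^ 2 = -(x 0 ^ 2 + x 1 ^ 2 + x 2 ^ 2) := by linear_combination hsum
  have s03 : x 0 * x 3 ^ 2 = -(x 0 * x 1 ^ 2 + x 0 * x 2 ^ 2) := by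
    linear_combination x 0 * hsum - c0
  have s10 : x 1 * x 0 ^ 2 = -(x 1 * x 2 ^ 2 + x 1 * x 3 ^ 2) := by
    linear_combination x 1 * hsum - c1
  have s21 : x 2 * x 1 ^ 2 = -(x 2 * x 3 ^ 2 + x 0 ^ 2 * x 2) := by
    linear_combination x 2 * hsum - c2
  have s32 : x 3 * x 2 ^ 2 = -(x 0 ^ 2 * x 3 + x 1 ^ 2 * x 3) := by
    linear_combination x 3 * hsum - c3
  have q03 : x 0 ^ 2 * x 3 ^ 2 = x 1 ^ 2 * x 2 ^ 2 := hdbl <| by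
    linear_combination (x 0 ^ 2 + x 3 ^ 2 - x 1 ^ 2 - x 2 ^ 2) * hsum - x 0 * c0 - x 3 * c3 +
      x 1 * c1 + x 2 * c2
  have q23 : x 2 ^ 2 * x 3 ^ 2 = x 0 ^ 2 * x 1 ^ 2 := hdbl <| by
    linear_combination (x 2 ^ 2 + x 3 ^ 2 - x 0 ^ 2 - x 1 ^ 2) * hsum - x 2 * c2 - x 3 * c3 +
      x 0 * c0 + x 1 * c1
  have q02 : x 0 ^ 2 * x 2 ^ 2 = -(x 0 ^ 2 * x 1 ^ 2 + x 1 ^ 2 * x 2 ^ 2) := by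
    linear_combination x 0 ^ 2 * hsum - x 0 * c0 - q03
  have q13 : x 1 ^ 2 * x 3 ^ 2 = -(x 0 ^ 2 * x 1 ^ 2 + x 1 ^ 2 * x 2 ^ 2) := by
    linear_combination x 1 ^ 2 * hsum - x 1 * c1
  simp only [Fin.forall_fin_succ, basisExponent, Fin.prod_univ_four] at hS
  simp at hS
  obtain ⟨m, m0, m1, m2, m3, m00, m11, m22, m01, m02, m03, m12, m13, m23, m011, m022, m122, m133,
    m233, m002, m003, m113, m0011, m1122⟩ := hS
  have m33 := s3 ▸ S.neg_mem (S.add_mem (S.add_mem m00 m11) m22)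
  have m033 := s03 ▸ S.neg_mem (S.add_mem m011 m022)
  have m100 := s10 ▸ S.neg_mem (S.add_mem m122 m133)
  have m211 := s21 ▸ S.neg_mem (S.add_mem m233 m002)
  have m322 := s32 ▸ S.neg_mem (S.add_mem m003 m113)
  have m0033 := q03 ▸ m1122
  have m2233 := q23 ▸ m0011
  have m0022 := q02 ▸ S.neg_mem (S.add_mem m0011 m1122)
  have m1133 := q13 ▸ S.neg_mem (S.add_mem m0011 m1122)
  cases ha with
  | one => exact m
  | var i => fin_cases i <;> assumption
  | mul i j =>
    fin_cases i <;> fin_cases j <;>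
      first | assumption | (rw [mul_comm]; assumption) | (rw [← sq]; assumption)
  | mul_sq i j hij =>
    fin_cases i <;> fin_cases j <;>
      first | exact absurd rfl hij | assumption | (rw [mul_comm]; assumption)
  | sq_mul_sq i j hij =>
    fin_cases i <;> fin_cases j <;>
      first | exact absurd rfl hij | assumption | (rw [mul_comm]; assumption)

lemma span_basisMonomials (t : ℂ) :
    Submodule.span ℂ
      (Set.range fun i : Fin 24 => Ideal.Quotient.mk (grIdealIpp t) (_root_.basisMonomials i))
      = ⊤ := by
  refine eq_top_iff.2 fun y _ => ?_
  obtain ⟨f, rfl⟩ := Ideal.Quotient.mk_surjective y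
  let x (i : Fin 4) := Ideal.Quotient.mk (grIdealIpp t) (X i)
  have hcube (i : Fin 4) : x i ^ 3 = 0 :=
    Ideal.Quotient.eq_zero_iff_mem.2 (X_pow_three_mem t i)
  have hsum : x 0 ^ 2 + x 1 ^ 2 + x 2 ^ 2 + x 3 ^ 2 = 0 :=
    Ideal.Quotient.eq_zero_iff_mem.2 (sum_X_sq_mem t)
  have htriple (i j k : Fin 4) (hij : i < j) (hjk : j < k) : x i * x j * x k = 0 :=
    Ideal.Quotient.eq_zero_iff_mem.2 (X_mul_X_mul_X_mem t hij hjk)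
  have hf : aeval x f = Ideal.Quotient.mk (grIdealIpp t) f := by
    have h : aeval x = Ideal.Quotient.mkₐ ℂ (grIdealIpp t) := by
      ext i
      simp [x]
    rw [h, Ideal.Quotient.mkₐ_eq_mk]
  rw [← hf]
  refine Submodule.span_le.2 (fun a ha => ?_) (aeval_mem_span_isPairMonomial hcube htriple f)
  refine pairMonomial_mem_of_sum_sq hcube hsum (fun i => ?_) ha
  refine Submodule.subset_span ⟨i, ?_⟩
  simp only [basisMonomials_eq_prod, map_prod, map_pow, x]

/-- For `t ≠ 0`, the images of the 24 listed monomials form a `ℂ`-basis of the quotient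
`ℂ[x₁,x₂,x₃,x₄]/gr I''`. -/
theorem stmt10 (t : ℂ) (ht : t ≠ 0) :
    LinearIndependent ℂ
        (fun i : Fin 24 => Ideal.Quotient.mk (grIdealIpp t) (basisMonomials i))
      ∧ Submodule.span ℂ
          (Set.range fun i : Fin 24 => Ideal.Quotient.mk (grIdealIpp t) (basisMonomials i))
        = ⊤ :=
  ⟨linearIndependent_basisMonomials t ht, span_basisMonomials t⟩
end

section
/- Let a ≥ 1 be an integer, let d₀ ≥ 1 be an odd integer, and let b₁ ≥ b₂ ≥ … ≥ b_k ≥ 0 be integers with b₁ ≤ a such that every value occurs an even number of times in the list b₁,…,b_k. Let μ be the partition whose parts are: 2a+1 with multiplicity 1, 2a with multiplicity d₀ − 1, and 2b_j + 1 for j = 1,…,k. Then every part of the conjugate (transpose) partition of μ is odd. -/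
/-- If every fibre of `f` has even size, so does the preimage of any set of values. -/
theorem even_card_filter_comp {ι α : Type*} [Fintype ι] [DecidableEq α] (f : ι → α)
    (hf : ∀ x, Even (Finset.univ.filter fun i => f i = x).card)
    (p : α → Prop) [DecidablePred p] :
    Even (Finset.univ.filter fun i => p (f i)).card := by
  rw [Finset.card_eq_sum_card_fiberwise
    (t := (Finset.univ.image f).filter p) (f := f) (fun i hi => by simpa using hi)]
  refine Finset.even_sum _ fun x hx => ?_
  rw [Finset.filter_filter]
  have hpx : p x := (Finset.mem_filter.mp hx).2
  rw [Finset.filter_congr (q := fun i => f i = x)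
    fun i _ => ⟨And.right, fun h => ⟨h.symm ▸ hpx, h⟩⟩]
  exact hf x


/-- Let `a ≥ 1`, let `d₀ ≥ 1` be odd, and let `b₁ ≥ … ≥ b_k ≥ 0` be integers with `b₁ ≤ a`
such that every value occurs an even number of times among `b₁,…,b_k`.  Let `μ` be the
partition with parts `2a+1` (multiplicity 1), `2a` (multiplicity `d₀ − 1`) and `2b_j + 1`
for `j = 1,…,k`.  Then every part of the conjugate (transpose) partition of `μ` is odd;
that is, for every `j ≥ 1` the number `μᵗ_j = #{i : μ_i ≥ j}` of parts of `μ` of size `≥ j`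
is zero or odd. -/
theorem stmt12 (a : ℕ) (ha : 1 ≤ a) (d₀ : ℕ) (hd₀odd : Odd d₀) (hd₀pos : 1 ≤ d₀)
    (k : ℕ) (b : Fin k → ℕ)
    (hdecr : ∀ i j : Fin k, i ≤ j → b j ≤ b i)
    (hba : ∀ j : Fin k, b j ≤ a)
    (heven : ∀ m : ℕ, Even ((Finset.univ.filter fun j : Fin k => b j = m).card))
    (μ : Multiset ℕ)
    (hμ : μ = (2 * a + 1) ::ₘ
        (Multiset.replicate (d₀ - 1) (2 * a)
          + Multiset.map (fun j => 2 * b j + 1) (Finset.univ.val : Multiset (Fin k)))) :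
    ∀ j : ℕ, 0 < j →
      (μ.filter fun m => j ≤ m).card = 0 ∨ Odd (μ.filter fun m => j ≤ m).card := by
  intro j _
  have hb : Even ((Multiset.map (fun i => 2 * b i + 1) (Finset.univ.val : Multiset (Fin k))).filter
      fun m => j ≤ m).card := by
    rw [Multiset.filter_map, Multiset.card_map]
    exact even_card_filter_comp b heven fun m => j ≤ 2 * m + 1
  have hr : Even ((Multiset.replicate (d₀ - 1) (2 * a)).filter fun m => j ≤ m).card := by
    by_cases h : j ≤ 2 * a
    · rw [Multiset.filter_eq_self.mpr fun m hm => (Multiset.eq_of_mem_replicate hm).symm ▸ h,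
        Multiset.card_replicate]
      exact Nat.Odd.sub_odd hd₀odd odd_one
    · rw [Multiset.filter_eq_nil.mpr fun m hm => (Multiset.eq_of_mem_replicate hm).symm ▸ h]
      simp
  by_cases hj : j ≤ 2 * a + 1
  · right
    rw [hμ, Multiset.filter_cons_of_pos _ hj, Multiset.card_cons, Multiset.filter_add,
      Multiset.card_add]
    exact (hr.add hb).add_one
  · left
    rw [Multiset.card_eq_zero, Multiset.filter_eq_nil, hμ]
    intro m hm
    simp only [Multiset.mem_cons, Multiset.mem_add, Multiset.mem_replicate, Multiset.mem_map] at hm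
    rcases hm with rfl | ⟨_, rfl⟩ | ⟨i, _, rfl⟩
    · exact hj
    · omega
    · have := hba i
      omega
end
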